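/- arXiv:2309.01750 — 3 statements merged into one kernel-verified Lean document; each statement's English description precedes it below -/
import Mathlib

section
/- For every integer constant c ≥ 0 there exists n0 such that for every n ≥ n0 and every integer k with |2k − n| ≤ c, there is a ucp-irredundant CNF formula φℓ on n variables with |φℓ| = (k+1)·binom(n−1, k), and a CNF formula φ* ucp-equivalent to φℓ with |φ*| ≤ 6·(k+1)·C(n, k+1, k). -/
/-- A literal on variables `x_1, …, x_n`: a variable together with a polarity
(`true` = positive literal, `false` = negative literal). -/
abbrev Lit (n : ℕ) := Fin n × Bool

/-- A clause is a finite set of literals. -/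
abbrev Clause (n : ℕ) := Finset (Lit n)

/-- A CNF formula is a finite set of clauses. -/
abbrev CnfFormula (n : ℕ) := Finset (Clause n)

/-- Negation of a literal. -/
def negLit {n : ℕ} (l : Lit n) : Lit n := (l.1, !l.2)

/-- A clause is well-formed if its literals are on pairwise distinct variables. -/
def Clause.Wf {n : ℕ} (C : Clause n) : Prop :=
  ∀ l ∈ C, ∀ l' ∈ C, l.1 = l'.1 → l = l'

/-- A partial assignment: a set of literals containing no complementary pair. -/
def IsPartialAssignment {n : ℕ} (α : Finset (Lit n)) : Prop :=
  ∀ l ∈ α, negLit l ∉ α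

/-- The set of unit clauses corresponding to a set of literals. -/
def unitClauses {n : ℕ} (α : Finset (Lit n)) : CnfFormula n :=
  α.image (fun l => {l})

/-- `UcpDeriv φ l` says that `l` lies in the least set `U` of literals closed under
the rule: if `C ∈ φ`, `l ∈ C`, and the negation of every literal of `C \ {l}`
lies in `U`, then `l ∈ U`. -/
inductive UcpDeriv {n : ℕ} (φ : CnfFormula n) : Lit n → Prop
  | step (C : Clause n) (hC : C ∈ φ) (l : Lit n) (hl : l ∈ C)
      (h : ∀ l' ∈ C.erase l, UcpDeriv φ (negLit l')) : UcpDeriv φ l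

/-- The set of literals derived by unit clause propagation on `φ`. -/
def UcpSet {n : ℕ} (φ : CnfFormula n) : Set (Lit n) := {l | UcpDeriv φ l}

/-- UCP on `φ` reaches the contradiction `⊥`: for some clause `C ∈ φ`, the negation of
every literal of `C` is derived. -/
def UcpBot {n : ℕ} (φ : CnfFormula n) : Prop :=
  ∃ C ∈ φ, ∀ l ∈ C, UcpDeriv φ (negLit l)

/-- Formulas `φ₁` and `φ₂` are ucp-equivalent: for every partial assignment `α`,
`UCP(φ₁ ∪ α) = UCP(φ₂ ∪ α)` (either both are `{⊥}`, or neither is and the derived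
sets of literals coincide). -/
def UcpEquiv {n : ℕ} (φ₁ φ₂ : CnfFormula n) : Prop :=
  ∀ α : Finset (Lit n), IsPartialAssignment α →
    (UcpBot (φ₁ ∪ unitClauses α) ↔ UcpBot (φ₂ ∪ unitClauses α)) ∧
    (¬ UcpBot (φ₁ ∪ unitClauses α) →
      UcpSet (φ₁ ∪ unitClauses α) = UcpSet (φ₂ ∪ unitClauses α))

/-- A total assignment satisfies a literal. -/
def SatLit {n : ℕ} (a : Fin n → Bool) (l : Lit n) : Prop := a l.1 = l.2

/-- A total assignment satisfies a clause if it satisfies some literal of it. -/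
def SatClause {n : ℕ} (a : Fin n → Bool) (C : Clause n) : Prop := ∃ l ∈ C, SatLit a l

/-- A total assignment satisfies a formula if it satisfies every clause of it. -/
def SatFormula {n : ℕ} (a : Fin n → Bool) (φ : CnfFormula n) : Prop :=
  ∀ C ∈ φ, SatClause a C


/-- The length `‖φ‖` of a formula: the sum of the numbers of literals of its clauses. -/
def formulaLen {n : ℕ} (φ : CnfFormula n) : ℕ := ∑ C ∈ φ, C.card

/-- The set of negations of the literals in `S`. -/
def negLits {n : ℕ} (S : Finset (Lit n)) : Finset (Lit n) := S.image negLit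

/-- A clause `C` is absorbed by a formula `φ`: for every literal `l ∈ C`,
`UCP(φ ∪ neg'(C \ {l}))` contains `l` or equals `{⊥}`. -/
def Absorbed {n : ℕ} (φ : CnfFormula n) (C : Clause n) : Prop :=
  ∀ l ∈ C,
    UcpDeriv (φ ∪ unitClauses (negLits (C.erase l))) l ∨
    UcpBot (φ ∪ unitClauses (negLits (C.erase l)))

/-- A formula is ucp-irredundant if no clause `C ∈ φ` is absorbed by `φ \ {C}`. -/
def UcpIrredundant {n : ℕ} (φ : CnfFormula n) : Prop :=
  ∀ C ∈ φ, ¬ Absorbed (φ.erase C) C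

/-- `F` is a covering system witnessing `C(n, r, k)`: a family of `r`-element subsets of an
`n`-element set such that every `k`-element subset is contained in at least one member. -/
def IsCoveringSystem (n r k : ℕ) (F : Finset (Finset (Fin n))) : Prop :=
  (∀ e ∈ F, e.card = r) ∧ ∀ s : Finset (Fin n), s.card = k → ∃ e ∈ F, s ⊆ e

/-- The covering number `C(n, r, k)`: the smallest size of a family of `r`-element subsets
of an `n`-element set such that every `k`-element subset is contained in at least one
member of the family. -/
noncomputable def coverNum (n r k : ℕ) : ℕ :=
  sInf {m | ∃ F : Finset (Finset (Fin n)), IsCoveringSystem n r k F ∧ F.card = m}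

section Propagation

variable {n : ℕ}

theorem UcpDeriv.satLit {φ : CnfFormula n} {a : Fin n → Bool} (ha : SatFormula a φ) {l : Lit n}
    (h : UcpDeriv φ l) : SatLit a l := by
  induction h with
  | step C hC l hl _ ih =>
    obtain ⟨l', hl', hs⟩ := ha C hC
    by_cases he : l' = l
    · exact he ▸ hs
    · have := ih l' (Finset.mem_erase.2 ⟨he, hl'⟩)
      simp only [SatLit, negLit] at this hs
      simp [hs] at this

theorem SatFormula.not_ucpBot {φ : CnfFormula n} {a : Fin n → Bool} (ha : SatFormula a φ) :
    ¬ UcpBot φ := by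
  rintro ⟨C, hC, h⟩
  obtain ⟨l, hl, hs⟩ := ha C hC
  have := (h l hl).satLit ha
  simp only [SatLit, negLit] at this hs
  simp [hs] at this

theorem UcpDeriv.of_mem {φ : CnfFormula n} {α : Finset (Lit n)} {l : Lit n} (h : l ∈ α) :
    UcpDeriv (φ ∪ unitClauses α) l :=
  .step {l} (Finset.mem_union_right _ (Finset.mem_image_of_mem _ h)) l (by simp) (by simp)

theorem satFormula_union_unitClauses {φ : CnfFormula n} {α : Finset (Lit n)} {a : Fin n → Bool}
    (hφ : SatFormula a φ) (hα : ∀ l ∈ α, SatLit a l) : SatFormula a (φ ∪ unitClauses α) := by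
  intro C hC
  rcases Finset.mem_union.1 hC with h | h
  · exact hφ C h
  · obtain ⟨l, hl, rfl⟩ := Finset.mem_image.1 h
    exact ⟨l, by simp, hα l hl⟩

/-- The clause on the variables of `S` whose only positive literal is `x`. -/
def hornClause (S : Finset (Fin n)) (x : Fin n) : Clause n :=
  S.image fun y => (y, decide (y = x))

theorem mem_hornClause {S : Finset (Fin n)} {x : Fin n} {l : Lit n} :
    l ∈ hornClause S x ↔ l.1 ∈ S ∧ l.2 = decide (l.1 = x) := by
  simp only [hornClause, Finset.mem_image]
  constructor
  · rintro ⟨y, hy, rfl⟩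
    exact ⟨hy, rfl⟩
  · rintro ⟨h1, h2⟩
    exact ⟨l.1, h1, Prod.ext rfl h2.symm⟩

theorem hornClause_wf (S : Finset (Fin n)) (x : Fin n) : Clause.Wf (hornClause S x) := by
  intro l hl l' hl' h
  rw [mem_hornClause] at hl hl'
  exact Prod.ext h (by rw [hl.2, hl'.2, h])

theorem hornClause_injective {S S' : Finset (Fin n)} {x x' : Fin n} (hx : x ∈ S)
    (h : hornClause S x = hornClause S' x') : S = S' ∧ x = x' := by
  constructor
  · have := congrArg (Finset.image Prod.fst) h
    simpa [hornClause, Finset.image_image, Function.comp_def] using this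
  · have hm : ((x, true) : Lit n) ∈ hornClause S x := mem_hornClause.2 ⟨hx, by simp⟩
    rw [h, mem_hornClause] at hm
    simpa using hm.2

/-- The formula consisting of the clauses `hornClause S x` for `(S, x) ∈ E`. -/
def hornFormula (E : Finset (Finset (Fin n) × Fin n)) : CnfFormula n :=
  E.image fun p => hornClause p.1 p.2

theorem mem_hornFormula {E : Finset (Finset (Fin n) × Fin n)} {C : Clause n} :
    C ∈ hornFormula E ↔ ∃ S x, (S, x) ∈ E ∧ hornClause S x = C := by
  simp [hornFormula]

theorem hornFormula_wf (E : Finset (Finset (Fin n) × Fin n)) :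
    ∀ C ∈ hornFormula E, Clause.Wf C := by
  intro C hC
  obtain ⟨S, x, -, rfl⟩ := mem_hornFormula.1 hC
  exact hornClause_wf S x

theorem UcpDeriv.horn_pos {φ : CnfFormula n} {S : Finset (Fin n)} {x : Fin n}
    (hC : hornClause S x ∈ φ) (hx : x ∈ S) (h : ∀ y ∈ S, y ≠ x → UcpDeriv φ (y, true)) :
    UcpDeriv φ (x, true) := by
  refine .step _ hC _ (mem_hornClause.2 ⟨hx, by simp⟩) ?_
  rintro ⟨y, b⟩ hy
  obtain ⟨hne, hy⟩ := Finset.mem_erase.1 hy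
  obtain ⟨hyS, hb⟩ := mem_hornClause.1 hy
  have hyx : y ≠ x := by
    rintro rfl
    simp_all
  have hb : b = false := by simpa [hyx] using hb
  subst hb
  exact h y hyS hyx

theorem UcpDeriv.horn_neg {φ : CnfFormula n} {S : Finset (Fin n)} {x z : Fin n}
    (hC : hornClause S x ∈ φ) (hz : z ∈ S) (hzx : z ≠ x) (hx : UcpDeriv φ (x, false))
    (h : ∀ y ∈ S, y ≠ x → y ≠ z → UcpDeriv φ (y, true)) :
    UcpDeriv φ (z, false) := by
  refine .step _ hC _ (mem_hornClause.2 ⟨hz, by simp [hzx]⟩) ?_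
  rintro ⟨y, b⟩ hy
  obtain ⟨hne, hy⟩ := Finset.mem_erase.1 hy
  obtain ⟨hyS, hb⟩ := mem_hornClause.1 hy
  dsimp only at hyS hb
  by_cases hyx : y = x
  · subst hyx
    simpa [negLit, hb] using hx
  · have hb : b = false := by simpa [hyx] using hb
    subst hb
    exact h y hyS hyx (by simpa using hne)

/-- Every pair `(S, x) ∈ E` consists of a set of size `j + 2` and one of its elements. -/
def IsHornSystem (j : ℕ) (E : Finset (Finset (Fin n) × Fin n)) : Prop :=
  ∀ p ∈ E, p.2 ∈ p.1 ∧ p.1.card = j + 2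

/-- For each set `P` of size `j`, the digraph on the complement of `P` with an arc from `a` to `b`
whenever `(P ∪ {a, b}, b) ∈ E` is strongly connected. -/
def LinksConnected (j : ℕ) (E : Finset (Finset (Fin n) × Fin n)) : Prop :=
  ∀ P : Finset (Fin n), P.card = j → ∀ W : Finset (Fin n), Disjoint P W → W.Nonempty →
    (∃ b, b ∉ W ∧ b ∉ P) → ∃ a ∈ W, ∃ b, b ∉ W ∧ b ∉ P ∧ (insert a (insert b P), b) ∈ E

/-- The variables assigned the value true by `α`. -/
def positives (α : Finset (Lit n)) : Finset (Fin n) := Finset.univ.filter fun x => (x, true) ∈ α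

theorem mem_positives {α : Finset (Lit n)} {x : Fin n} : x ∈ positives α ↔ (x, true) ∈ α := by
  simp [positives]

variable {j : ℕ} {E : Finset (Finset (Fin n) × Fin n)}

theorem LinksConnected.deriv_pos (hE : LinksConnected j E) {α : Finset (Lit n)}
    (hα : j + 1 ≤ (positives α).card) (x : Fin n) :
    UcpDeriv (hornFormula E ∪ unitClauses α) (x, true) := by
  classical
  set φ := hornFormula E ∪ unitClauses α
  let T : Finset (Fin n) := Finset.univ.filter fun x => UcpDeriv φ (x, true)
  have hT : ∀ y, y ∈ T ↔ UcpDeriv φ (y, true) := by simp [T]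
  by_contra hx
  have hsub : positives α ⊆ T := fun y hy => (hT y).2 (.of_mem (mem_positives.1 hy))
  have hcard := hα.trans (Finset.card_le_card hsub)
  obtain ⟨P, hPT, hP⟩ := Finset.exists_subset_card_eq (show j ≤ T.card by omega)
  obtain ⟨a, ha, b, hbW, hbP, hab⟩ := hE P hP (T \ P) Finset.disjoint_sdiff
    (Finset.card_pos.1 (by rw [Finset.card_sdiff_of_subset hPT]; omega))
    ⟨x, by simp [hT, hx], fun h => hx ((hT x).1 (hPT h))⟩
  have hbT : b ∉ T := fun h => hbW (Finset.mem_sdiff.2 ⟨h, hbP⟩)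
  refine hbT ((hT b).2 (UcpDeriv.horn_pos (S := insert a (insert b P))
    (Finset.mem_union_left _ (mem_hornFormula.2 ⟨_, _, hab, rfl⟩)) (by simp) ?_))
  intro y hy hyb
  rw [← hT]
  rcases Finset.mem_insert.1 hy with rfl | hy
  · exact (Finset.mem_sdiff.1 ha).1
  · exact hPT ((Finset.mem_insert.1 hy).resolve_left hyb)

theorem LinksConnected.deriv_neg (hE : LinksConnected j E) {α : Finset (Lit n)}
    (hα : IsPartialAssignment α) (hpos : (positives α).card = j) {v : Fin n} (hv : (v, false) ∈ α)
    {x : Fin n} (hx : x ∉ positives α) :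
    UcpDeriv (hornFormula E ∪ unitClauses α) (x, false) := by
  classical
  set φ := hornFormula E ∪ unitClauses α
  let W : Finset (Fin n) :=
    Finset.univ.filter fun x => x ∉ positives α ∧ ¬ UcpDeriv φ (x, false)
  have hW : ∀ y, y ∈ W ↔ y ∉ positives α ∧ ¬ UcpDeriv φ (y, false) := by simp [W]
  by_contra hxn
  obtain ⟨a, ha, b, hbW, hbP, hab⟩ := hE (positives α) hpos W
    (Finset.disjoint_left.2 fun y hy h => ((hW y).1 h).1 hy) ⟨x, (hW x).2 ⟨hx, hxn⟩⟩
    ⟨v, fun h => ((hW v).1 h).2 (.of_mem hv), fun h => hα _ hv (mem_positives.1 h)⟩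
  have hb : UcpDeriv φ (b, false) := by
    by_contra h
    exact hbW ((hW b).2 ⟨hbP, h⟩)
  refine ((hW a).1 ha).2 (UcpDeriv.horn_neg (S := insert a (insert b (positives α))) (x := b)
    (Finset.mem_union_left _ (mem_hornFormula.2 ⟨_, _, hab, rfl⟩)) (by simp) ?_ hb ?_)
  · rintro rfl
    exact hbW ha
  · intro y hy hyb hya
    simp only [Finset.mem_insert, hya, hyb, false_or] at hy
    exact .of_mem (mem_positives.1 hy)

theorem IsHornSystem.satFormula_of_card_le (hE : IsHornSystem j E) {T : Finset (Fin n)}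
    (hT : T.card ≤ j) : SatFormula (fun x => decide (x ∈ T)) (hornFormula E) := by
  intro C hC
  obtain ⟨S, x, hS, rfl⟩ := mem_hornFormula.1 hC
  obtain ⟨hx, hcard⟩ := hE _ hS
  dsimp only at hx hcard
  obtain ⟨y, hy, hyT⟩ : ∃ y ∈ S.erase x, y ∉ T := by
    by_contra! h
    have := Finset.card_le_card (show S.erase x ⊆ T from h)
    rw [Finset.card_erase_of_mem hx] at this
    omega
  obtain ⟨hyx, hyS⟩ := Finset.mem_erase.1 hy
  exact ⟨(y, false), mem_hornClause.2 ⟨hyS, by simp [hyx]⟩, by simp [SatLit, hyT]⟩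

theorem IsHornSystem.satFormula_true (hE : IsHornSystem j E) :
    SatFormula (fun _ => true) (hornFormula E) := by
  intro C hC
  obtain ⟨S, x, hS, rfl⟩ := mem_hornFormula.1 hC
  exact ⟨(x, true), mem_hornClause.2 ⟨(hE _ hS).1, by simp⟩, rfl⟩

theorem IsHornSystem.mem_of_deriv (hE : IsHornSystem j E) {α : Finset (Lit n)}
    (hcard : (positives α).card ≤ j)
    (hα : (positives α).card = j → ∀ v, (v, false) ∉ α) {l : Lit n}
    (h : UcpDeriv (hornFormula E ∪ unitClauses α) l) : l ∈ α := by
  induction h with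
  | step C hC l hl _ ih =>
    rcases Finset.mem_union.1 hC with h | h
    · exfalso
      obtain ⟨S, x, hS, rfl⟩ := mem_hornFormula.1 h
      obtain ⟨hx, hSc⟩ := hE _ hS
      dsimp only at hx hSc
      obtain ⟨hlS, hl2⟩ := mem_hornClause.1 hl
      have key : (S.erase l.1).erase x ⊆ positives α := by
        intro y hy
        simp only [Finset.mem_erase] at hy
        have := ih (y, false) (Finset.mem_erase.2
          ⟨fun h => hy.2.1 (congrArg Prod.fst h), mem_hornClause.2 ⟨hy.2.2, by simp [hy.1]⟩⟩)
        exact mem_positives.2 this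
      have hle := Finset.card_le_card key
      by_cases hlx : l.1 = x
      · rw [hlx, Finset.erase_eq_of_notMem (Finset.notMem_erase _ _),
          Finset.card_erase_of_mem hx] at hle
        omega
      · rw [Finset.card_erase_of_mem (Finset.mem_erase.2 ⟨Ne.symm hlx, hx⟩),
          Finset.card_erase_of_mem hlS] at hle
        refine hα (by omega) x (ih (x, true) (Finset.mem_erase.2 ⟨fun h => ?_, ?_⟩))
        · exact hlx (congrArg Prod.fst h).symm
        · exact mem_hornClause.2 ⟨hx, by simp⟩
    · obtain ⟨l', hl', rfl⟩ := Finset.mem_image.1 h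
      rw [Finset.mem_singleton.1 hl]
      exact hl'

theorem satLit_positives {α : Finset (Lit n)} (hα : IsPartialAssignment α) :
    ∀ l ∈ α, SatLit (fun x => decide (x ∈ positives α)) l := by
  rintro ⟨x, b⟩ hl
  cases b
  · simpa [SatLit, mem_positives, negLit] using hα _ hl
  · simpa [SatLit, mem_positives] using hl

/-- All Horn systems with strongly connected links have the same unit propagation behaviour. -/
theorem ucpEquiv_hornFormula {E' : Finset (Finset (Fin n) × Fin n)} (hE : IsHornSystem j E)
    (hEc : LinksConnected j E) (hE' : IsHornSystem j E') (hEc' : LinksConnected j E') :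
    UcpEquiv (hornFormula E) (hornFormula E') := by
  intro α hα
  rcases le_or_gt (j + 1) (positives α).card with hc | hc
  · by_cases hv : ∃ v, (v, false) ∈ α
    · obtain ⟨v, hv⟩ := hv
      have bot : ∀ {D}, LinksConnected j D → UcpBot (hornFormula D ∪ unitClauses α) := by
        intro D hD
        refine ⟨{(v, false)}, Finset.mem_union_right _ (Finset.mem_image_of_mem _ hv), ?_⟩
        simpa [negLit] using hD.deriv_pos hc v
      exact ⟨iff_of_true (bot hEc) (bot hEc'), fun h => absurd (bot hEc) h⟩
    · have sat : ∀ {D}, IsHornSystem j D →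
          SatFormula (fun _ => true) (hornFormula D ∪ unitClauses α) := by
        intro D hD
        refine satFormula_union_unitClauses hD.satFormula_true ?_
        rintro ⟨x, b⟩ hl
        cases b
        · exact absurd ⟨x, hl⟩ hv
        · rfl
      have set_eq : ∀ {D}, IsHornSystem j D → LinksConnected j D →
          UcpSet (hornFormula D ∪ unitClauses α) = {l | l.2 = true} := by
        intro D hD hDc
        ext ⟨x, b⟩
        refine ⟨fun h => (h.satLit (sat hD)).symm, ?_⟩
        rintro (rfl : b = true)
        exact hDc.deriv_pos hc x
      exact ⟨iff_of_false (sat hE).not_ucpBot (sat hE').not_ucpBot,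
        fun _ => (set_eq hE hEc).trans (set_eq hE' hEc').symm⟩
  · have sat : ∀ {D}, IsHornSystem j D → SatFormula (fun x => decide (x ∈ positives α))
        (hornFormula D ∪ unitClauses α) := fun hD =>
      satFormula_union_unitClauses (hD.satFormula_of_card_le (by omega)) (satLit_positives hα)
    refine ⟨iff_of_false (sat hE).not_ucpBot (sat hE').not_ucpBot, fun _ => ?_⟩
    by_cases hv : (positives α).card = j ∧ ∃ v, (v, false) ∈ α
    · obtain ⟨hj, v, hv⟩ := hv
      have set_eq : ∀ {D}, IsHornSystem j D → LinksConnected j D →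
          UcpSet (hornFormula D ∪ unitClauses α) =
            {l | SatLit (fun x => decide (x ∈ positives α)) l} := by
        intro D hD hDc
        ext ⟨x, b⟩
        refine ⟨fun h => h.satLit (sat hD), fun h => ?_⟩
        cases b
        · exact hDc.deriv_neg hα hj hv (by simpa [SatLit] using h)
        · exact .of_mem (mem_positives.1 (by simpa [SatLit] using h))
      exact (set_eq hE hEc).trans (set_eq hE' hEc').symm
    · have set_eq : ∀ {D}, IsHornSystem j D →
          UcpSet (hornFormula D ∪ unitClauses α) = ↑α := by
        intro D hD
        ext l
        exact ⟨fun h => hD.mem_of_deriv (by omega) (fun h1 v h2 => hv ⟨h1, v, h2⟩) h,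
          fun h => .of_mem h⟩
      exact (set_eq hE).trans (set_eq hE').symm

end Propagation

section PinnedFormula

variable {n : ℕ}

/-- All pairs `(S, x)` with `x ∈ S`, `z ∈ S` and `|S| = j + 2`. -/
def pinnedSystem (j : ℕ) (z : Fin n) : Finset (Finset (Fin n) × Fin n) :=
  ((Finset.univ.powersetCard (j + 2)).filter (z ∈ ·) ×ˢ Finset.univ).filter fun p => p.2 ∈ p.1

theorem mem_pinnedSystem {j : ℕ} {z : Fin n} {p : Finset (Fin n) × Fin n} :
    p ∈ pinnedSystem j z ↔ p.1.card = j + 2 ∧ z ∈ p.1 ∧ p.2 ∈ p.1 := by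
  simp [pinnedSystem, Finset.mem_powersetCard, and_assoc]

theorem isHornSystem_pinnedSystem (j : ℕ) (z : Fin n) : IsHornSystem j (pinnedSystem j z) :=
  fun _ hp => ⟨(mem_pinnedSystem.1 hp).2.2, (mem_pinnedSystem.1 hp).1⟩

theorem card_insert_insert_of_notMem {α : Type*} [DecidableEq α] {a b : α} {P : Finset α}
    (hab : a ≠ b) (ha : a ∉ P) (hb : b ∉ P) : (insert a (insert b P)).card = P.card + 2 := by
  rw [Finset.card_insert_of_notMem (by simp [hab, ha]), Finset.card_insert_of_notMem hb]

theorem linksConnected_pinnedSystem (j : ℕ) (z : Fin n) :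
    LinksConnected j (pinnedSystem j z) := by
  rintro P hP W hPW ⟨a, ha⟩ ⟨b, hbW, hbP⟩
  have key : ∀ a ∈ W, ∀ b, b ∉ W → b ∉ P → z ∈ insert a (insert b P) →
      (insert a (insert b P), b) ∈ pinnedSystem j z := by
    intro a ha b hbW hbP hz
    refine mem_pinnedSystem.2 ⟨?_, hz, by simp⟩
    rw [← hP]
    refine card_insert_insert_of_notMem ?_ (fun h => Finset.disjoint_left.1 hPW h ha) hbP
    rintro rfl
    exact hbW ha
  by_cases hzW : z ∈ W
  · exact ⟨z, hzW, b, hbW, hbP, key z hzW b hbW hbP (by simp)⟩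
  by_cases hzP : z ∈ P
  · exact ⟨a, ha, b, hbW, hbP, key a ha b hbW hbP (by simp [hzP])⟩
  · exact ⟨a, ha, z, hzW, hzP, key a ha z hzW hzP (by simp)⟩

theorem card_hornFormula_pinnedSystem (j : ℕ) (z : Fin n) :
    (hornFormula (pinnedSystem j z)).card = (j + 2) * (n - 1).choose (j + 1) := by
  rw [hornFormula, Finset.card_image_of_injOn]
  · rw [pinnedSystem, Finset.card_filter, Finset.sum_product]
    have : ∀ S ∈ (Finset.univ.powersetCard (j + 2)).filter (z ∈ ·),
        (∑ x : Fin n, if x ∈ S then 1 else 0) = j + 2 := by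
      intro S hS
      simp only [Finset.mem_filter, Finset.mem_powersetCard] at hS
      simp [hS.1.2]
    rw [Finset.sum_congr rfl this, Finset.sum_const, smul_eq_mul, mul_comm]
    congr 1
    rw [show n - 1 = (Finset.univ.erase z).card by simp, ← Finset.card_powersetCard]
    refine (Finset.card_bij (fun T _ => insert z T) ?_ ?_ ?_).symm
    · intro T hT
      obtain ⟨hT, hc⟩ := Finset.mem_powersetCard.1 hT
      have : z ∉ T := fun h => Finset.notMem_erase _ _ (hT h)
      simp [Finset.mem_powersetCard, Finset.card_insert_of_notMem this, hc]
    · intro T hT T' hT' h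
      have h1 : z ∉ T := fun h => Finset.notMem_erase _ _ ((Finset.mem_powersetCard.1 hT).1 h)
      have h2 : z ∉ T' := fun h => Finset.notMem_erase _ _ ((Finset.mem_powersetCard.1 hT').1 h)
      rw [← Finset.erase_insert h1, h, Finset.erase_insert h2]
    · intro S hS
      simp only [Finset.mem_filter, Finset.mem_powersetCard] at hS
      refine ⟨S.erase z, Finset.mem_powersetCard.2 ⟨?_, ?_⟩, Finset.insert_erase hS.2⟩
      · exact Finset.erase_subset_erase _ (Finset.subset_univ _)
      · rw [Finset.card_erase_of_mem hS.2, hS.1.2]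
        rfl
  · rintro ⟨S, x⟩ hS ⟨S', x'⟩ _ h
    obtain ⟨rfl, rfl⟩ := hornClause_injective (mem_pinnedSystem.1 hS).2.2 h
    rfl

theorem mem_negLits_erase_hornClause {S : Finset (Fin n)} {x : Fin n} {l m : Lit n}
    (hm : m ∈ hornClause S x) :
    l ∈ negLits ((hornClause S x).erase m) ↔ l.1 ∈ S ∧ l.1 ≠ m.1 ∧ l.2 = !decide (l.1 = x) := by
  obtain ⟨hmS, hm2⟩ := mem_hornClause.1 hm
  simp only [negLits, Finset.mem_image, Finset.mem_erase, mem_hornClause, negLit]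
  constructor
  · rintro ⟨y, ⟨hne, hy, hy2⟩, rfl⟩
    exact ⟨hy, fun h => hne (Prod.ext h (by rw [hy2, hm2, h])), by rw [hy2]⟩
  · rintro ⟨h1, h2, h3⟩
    refine ⟨(l.1, !l.2), ⟨fun h => h2 (congrArg Prod.fst h :), h1, by simp [h3]⟩, by simp⟩

/-- No clause of the pinned formula is absorbed by the others: its positive literal witnesses this
if it is `z`, and otherwise the literal on `z` does. -/
theorem ucpIrredundant_pinnedSystem (j : ℕ) (z : Fin n) :
    UcpIrredundant (hornFormula (pinnedSystem j z)) := by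
  intro C hC habs
  obtain ⟨S, x, hS, rfl⟩ := mem_hornFormula.1 hC
  obtain ⟨hcard, hzS, hxS⟩ := mem_pinnedSystem.1 hS
  dsimp only at hcard hzS hxS
  by_cases hxz : x = z
  · subst hxz
    have hm : ((x, true) : Lit n) ∈ hornClause S x := mem_hornClause.2 ⟨hzS, by simp⟩
    have sat : SatFormula (fun y => decide (y ∈ S.erase x))
        ((hornFormula (pinnedSystem j x)).erase (hornClause S x) ∪
          unitClauses (negLits ((hornClause S x).erase (x, true)))) := by
      refine satFormula_union_unitClauses ?_ ?_
      · intro C hC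
        obtain ⟨hne, hC⟩ := Finset.mem_erase.1 hC
        obtain ⟨S', x', hS', rfl⟩ := mem_hornFormula.1 hC
        obtain ⟨hc', hz', hx'⟩ := mem_pinnedSystem.1 hS'
        dsimp only at hc' hz' hx'
        by_contra hunsat
        have hx'T : x' ∉ S.erase x := fun h =>
          hunsat ⟨(x', true), mem_hornClause.2 ⟨hx', by simp⟩, by simp only [SatLit, h, decide_true]⟩
        have hsub : S'.erase x' ⊆ S.erase x := by
          intro y hy
          obtain ⟨hyx, hyS⟩ := Finset.mem_erase.1 hy
          by_contra h
          exact hunsat ⟨(y, false), mem_hornClause.2 ⟨hyS, by simp [hyx]⟩,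
            by simp only [SatLit, h, decide_false]⟩
        have hxx : x' = x := by
          by_contra h
          exact Finset.notMem_erase x S (hsub (Finset.mem_erase.2 ⟨Ne.symm h, hz'⟩))
        subst hxx
        have : S' = S := by
          have := Finset.eq_of_subset_of_card_le hsub (by
            rw [Finset.card_erase_of_mem hx', Finset.card_erase_of_mem hxS, hcard, hc'])
          rw [← Finset.insert_erase hx', this, Finset.insert_erase hxS]
        exact hne (by rw [this])
      · intro l hl
        obtain ⟨h1, h2, h3⟩ := (mem_negLits_erase_hornClause hm).1 hl
        dsimp only at h2
        simp [SatLit, h1, h2, h3]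
    rcases habs _ hm with h | h
    · simpa [SatLit] using h.satLit sat
    · exact sat.not_ucpBot h
  · have hm : ((z, false) : Lit n) ∈ hornClause S x :=
      mem_hornClause.2 ⟨hzS, by simp [Ne.symm hxz]⟩
    set α := negLits ((hornClause S x).erase (z, false))
    have hmem : ∀ {l : Lit n}, l ∈ α ↔ l.1 ∈ S ∧ l.1 ≠ z ∧ l.2 = !decide (l.1 = x) :=
      mem_negLits_erase_hornClause hm
    have closed : ∀ l, UcpDeriv ((hornFormula (pinnedSystem j z)).erase (hornClause S x) ∪
        unitClauses α) l → l ∈ α := by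
      intro l hl
      induction hl with
      | step C hC l hl _ ih =>
        rcases Finset.mem_union.1 hC with h | h
        · exfalso
          obtain ⟨hne, hC⟩ := Finset.mem_erase.1 h
          obtain ⟨S', x', hS', rfl⟩ := mem_hornFormula.1 hC
          obtain ⟨hc', hz', hx'⟩ := mem_pinnedSystem.1 hS'
          dsimp only at hc' hz' hx'
          have hlit : ∀ y ∈ S', y ≠ l.1 → (y, !decide (y = x')) ∈ α := by
            intro y hy hyl
            exact ih (y, decide (y = x')) (Finset.mem_erase.2
              ⟨fun h => hyl (congrArg Prod.fst h), mem_hornClause.2 ⟨hy, rfl⟩⟩)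
          have hlz : l.1 = z := by
            by_contra h
            exact (hmem.1 (hlit z hz' (Ne.symm h))).2.1 rfl
          rw [hlz] at hlit
          have hSS : S' = S := by
            refine Finset.eq_of_subset_of_card_le (fun y hy => ?_) (by rw [hcard, hc'])
            by_cases hyz : y = z
            · exact hyz ▸ hzS
            · exact (hmem.1 (hlit y hy hyz)).1
          subst hSS
          have hxx := (hmem.1 (hlit x hxS hxz)).2.2
          simp only [decide_true, Bool.not_true, Bool.not_eq_eq_eq_not, Bool.not_false,
            decide_eq_true_eq] at hxx
          exact hne (by rw [hxx])
        · obtain ⟨l', hl', rfl⟩ := Finset.mem_image.1 h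
          rw [Finset.mem_singleton.1 hl]
          exact hl'
    rcases habs _ hm with h | ⟨C, hC, h⟩
    · exact (hmem.1 (closed _ h)).2.1 rfl
    · rcases Finset.mem_union.1 hC with hC | hC
      · obtain ⟨S', x', hS', rfl⟩ := mem_hornFormula.1 (Finset.mem_erase.1 hC).2
        have := h (z, decide (z = x')) (mem_hornClause.2 ⟨(mem_pinnedSystem.1 hS').2.1, rfl⟩)
        exact (hmem.1 (closed _ this)).2.1 rfl
      · obtain ⟨l, hl, rfl⟩ := Finset.mem_image.1 hC
        have h1 := (hmem.1 hl).2.2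
        have h2 := (hmem.1 (closed _ (h l (by simp)))).2.2
        exact Bool.not_ne_self _ (h2.trans h1.symm)

end PinnedFormula

section ClosedSets

theorem choose_le_choose_of_le_half {m i w : ℕ} (hi : i ≤ w) (hw : w ≤ m / 2) :
    m.choose i ≤ m.choose w := by
  induction w, hi using Nat.le_induction with
  | base => exact le_rfl
  | succ w _ ih => exact (ih (by omega)).trans (Nat.choose_le_succ_of_lt_half_left (by omega))

theorem sum_range_choose_le {m w : ℕ} (hw : w ≤ m / 2) :
    ∑ i ∈ Finset.range (w + 1), m.choose i ≤ (w + 1) * m.choose w :=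
  calc ∑ i ∈ Finset.range (w + 1), m.choose i
      ≤ ∑ _i ∈ Finset.range (w + 1), m.choose w := Finset.sum_le_sum fun _ hi =>
        choose_le_choose_of_le_half (Nat.lt_succ_iff.1 (Finset.mem_range.1 hi)) hw
    _ = (w + 1) * m.choose w := by simp

/-- In a graph without isolated vertices in `V`, there are few unions of components of a given
size `w`: a pair of them is determined by a set of at most `w` vertices. -/
theorem card_closed_sq_le {α : Type*} [Fintype α] [DecidableEq α] (G : SimpleGraph α)
    (V : Finset α) (hV : ∀ v ∈ V, ∃ u, G.Adj v u) {w : ℕ} (𝒰 : Finset (Finset α))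
    (h𝒰 : ∀ U ∈ 𝒰, U ⊆ V ∧ U.card = w ∧ ∀ a ∈ U, ∀ b, G.Adj a b → b ∈ U) :
    𝒰.card ^ 2 ≤ ∑ i ∈ Finset.range (w + 1), V.card.choose i := by
  classical
  choose! nb hnb using hV
  let rep : α → α := fun v => (G.connectedComponentMk v).out
  have hrep : ∀ v, G.Reachable (rep v) v := fun v =>
    SimpleGraph.ConnectedComponent.exact (Quot.out_eq (G.connectedComponentMk v))
  have rep_eq : ∀ {u v}, G.Reachable u v → rep u = rep v := fun h =>
    congrArg Quot.out (SimpleGraph.ConnectedComponent.sound h)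
  have closed : ∀ U ∈ 𝒰, ∀ u v, G.Reachable u v → u ∈ U → v ∈ U := by
    rintro U hU u v ⟨p⟩
    induction p with
    | nil => exact id
    | cons hadj _ ih => exact fun hu => ih ((h𝒰 U hU).2.2 _ hu _ hadj)
  have sep : ∀ u ∈ V, ∀ v ∈ V, rep u = u → rep v = v → nb v ≠ u := by
    rintro u hu v hv hru hrv rfl
    have h : rep v = rep (nb v) := rep_eq (hnb v hv).reachable
    rw [hru, hrv] at h
    exact (hnb v hv).ne h
  have inj : ∀ u ∈ V, ∀ v ∈ V, rep u = u → rep v = v → nb u = nb v → u = v := by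
    intro u hu v hv hru hrv h
    rw [← hru, ← hrv, rep_eq (hnb u hu).reachable, rep_eq (hnb v hv).reachable, h]
  let R : Finset α → Finset α := fun U => U.filter fun v => rep v = v
  have hRV : ∀ U ∈ 𝒰, ∀ v ∈ R U, v ∈ V ∧ rep v = v ∧ v ∈ U := fun U hU v hv =>
    ⟨(h𝒰 U hU).1 (Finset.mem_filter.1 hv).1, (Finset.mem_filter.1 hv).2,
      (Finset.mem_filter.1 hv).1⟩
  have himg : ∀ U ∈ 𝒰, (R U).image nb ⊆ U := by
    intro U hU x hx
    obtain ⟨v, hv, rfl⟩ := Finset.mem_image.1 hx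
    obtain ⟨hvV, -, hvU⟩ := hRV U hU v hv
    exact (h𝒰 U hU).2.2 v hvU _ (hnb v hvV)
  have hdisj : ∀ U ∈ 𝒰, ∀ U' ∈ 𝒰, Disjoint (R U) ((R U').image nb) := by
    intro U hU U' hU'
    refine Finset.disjoint_left.2 fun u hu hu' => ?_
    obtain ⟨v, hv, rfl⟩ := Finset.mem_image.1 hu'
    exact sep _ (hRV U hU _ hu).1 v (hRV U' hU' v hv).1 (hRV U hU _ hu).2.1 (hRV U' hU' v hv).2.1 rfl
  have hcimg : ∀ U ∈ 𝒰, ((R U).image nb).card = (R U).card := fun U hU =>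
    Finset.card_image_of_injOn fun u hu v hv h =>
      inj u (hRV U hU u hu).1 v (hRV U hU v hv).1 (hRV U hU u hu).2.1 (hRV U hU v hv).2.1 h
  have hhalf : ∀ U ∈ 𝒰, 2 * (R U).card ≤ w := by
    intro U hU
    have := Finset.card_le_card (Finset.union_subset (Finset.filter_subset _ _) (himg U hU) :
      R U ∪ (R U).image nb ⊆ U)
    rw [Finset.card_union_of_disjoint (hdisj U hU U hU), hcimg U hU, (h𝒰 U hU).2.1] at this
    omega
  have mem_iff : ∀ U ∈ 𝒰, ∀ v, v ∈ U ↔ rep v ∈ R U := by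
    intro U hU v
    refine ⟨fun hv => Finset.mem_filter.2 ⟨closed U hU _ _ (hrep v).symm hv, rep_eq (hrep v)⟩,
      fun hv => closed U hU _ _ (hrep v) (hRV U hU _ hv).2.2⟩
  have R_inj : ∀ U ∈ 𝒰, ∀ U' ∈ 𝒰, R U = R U' → U = U' := by
    intro U hU U' hU' h
    ext v
    rw [mem_iff U hU, mem_iff U' hU', h]
  let code : Finset α × Finset α → Finset α := fun p => R p.1 ∪ (R p.2).image nb
  let X := (Finset.range (w + 1)).biUnion fun i => V.powersetCard i
  have hcode : Set.MapsTo code (𝒰 ×ˢ 𝒰 : Finset _) X := by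
    rintro ⟨U, U'⟩ hp
    obtain ⟨hU, hU'⟩ := Finset.mem_product.1 (Finset.mem_coe.1 hp)
    refine Finset.mem_coe.2 (Finset.mem_biUnion.2 ⟨(code (U, U')).card, ?_, ?_⟩)
    · have h1 := Finset.card_union_le (R U) ((R U').image nb)
      have h2 := hhalf U hU
      have h3 := hhalf U' hU'
      have h4 := hcimg U' hU'
      rw [Finset.mem_range]
      change (R U ∪ (R U').image nb).card < w + 1
      omega
    · refine Finset.mem_powersetCard.2 ⟨Finset.union_subset ?_ ?_, rfl⟩
      · exact fun v hv => (hRV U hU v hv).1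
      · exact (himg U' hU').trans (h𝒰 U' hU').1
  have hinj : Set.InjOn code (𝒰 ×ˢ 𝒰 : Finset _) := by
    rintro ⟨U₁, U₂⟩ hp ⟨U₁', U₂'⟩ hp' h
    obtain ⟨hU₁, hU₂⟩ := Finset.mem_product.1 (Finset.mem_coe.1 hp)
    obtain ⟨hU₁', hU₂'⟩ := Finset.mem_product.1 (Finset.mem_coe.1 hp')
    dsimp only at hU₁ hU₂ hU₁' hU₂'
    replace h : R U₁ ∪ (R U₂).image nb = R U₁' ∪ (R U₂').image nb := h
    have hfst : ∀ {A B A' B'}, A ∈ 𝒰 → B' ∈ 𝒰 → R A ∪ (R B).image nb = R A' ∪ (R B').image nb →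
        R A ⊆ R A' := fun hA hB' h v hv =>
      (Finset.mem_union.1 (h ▸ Finset.mem_union_left _ hv)).resolve_right
        (Finset.disjoint_left.1 (hdisj _ hA _ hB') hv)
    have hsnd : ∀ {A B A' B'}, B ∈ 𝒰 → A' ∈ 𝒰 → B' ∈ 𝒰 →
        R A ∪ (R B).image nb = R A' ∪ (R B').image nb → R B ⊆ R B' := by
      intro A B A' B' hB hA' hB' h v hv
      have hv' : nb v ∈ R A' ∪ (R B').image nb :=
        h ▸ Finset.mem_union_right _ (Finset.mem_image_of_mem _ hv)
      rcases Finset.mem_union.1 hv' with h' | h'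
      · exact absurd rfl (sep _ (hRV A' hA' _ h').1 v (hRV B hB v hv).1 (hRV A' hA' _ h').2.1
          (hRV B hB v hv).2.1)
      · obtain ⟨u, hu, huv⟩ := Finset.mem_image.1 h'
        rw [← inj u (hRV B' hB' u hu).1 v (hRV B hB v hv).1 (hRV B' hB' u hu).2.1
          (hRV B hB v hv).2.1 huv]
        exact hu
    exact Prod.ext
      (R_inj _ hU₁ _ hU₁' ((hfst hU₁ hU₂' h).antisymm (hfst hU₁' hU₂ h.symm)))
      (R_inj _ hU₂ _ hU₂' ((hsnd hU₂ hU₁' hU₂' h).antisymm (hsnd hU₂' hU₁ hU₂ h.symm)))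
  calc 𝒰.card ^ 2 = (𝒰 ×ˢ 𝒰).card := by rw [Finset.card_product, sq]
    _ ≤ X.card := Finset.card_le_card_of_injOn code hcode hinj
    _ ≤ ∑ i ∈ Finset.range (w + 1), (V.powersetCard i).card := Finset.card_biUnion_le
    _ = _ := by simp only [Finset.card_powersetCard]

end ClosedSets

section Averaging

/-- If `S` is an orbit of a finite group, a random group element moves `x ∈ S` into `A ⊆ S` with
probability `|A| / |S|`. -/
theorem card_mul_card_filter_smul_mem {G X : Type*} [Group G] [Fintype G] [MulAction G X]
    [DecidableEq X] {S A : Finset X} (hS : ∀ g : G, ∀ x ∈ S, g • x ∈ S)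
    (htrans : ∀ x ∈ S, ∀ y ∈ S, ∃ g : G, g • x = y) (hA : A ⊆ S) {x : X} (hx : x ∈ S) :
    S.card * (Finset.univ.filter fun g : G => g • x ∈ A).card = Fintype.card G * A.card := by
  have hconst : ∀ y ∈ S, (Finset.univ.filter fun g : G => g • y ∈ A).card =
      (Finset.univ.filter fun g : G => g • x ∈ A).card := by
    intro y hy
    obtain ⟨h, rfl⟩ := htrans x hx y hy
    exact Finset.card_equiv (Equiv.mulRight h) (by simp [mul_smul])
  have hfiber : ∀ g : G, (S.filter fun y => g • y ∈ A).card = A.card := by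
    intro g
    refine Finset.card_bij (fun y _ => g • y) (fun y hy => (Finset.mem_filter.1 hy).2)
      (fun y _ z _ h => smul_left_cancel g h) fun y hy => ?_
    exact ⟨g⁻¹ • y, Finset.mem_filter.2 ⟨hS _ _ (hA hy), by simpa using hy⟩, by simp⟩
  calc S.card * (Finset.univ.filter fun g : G => g • x ∈ A).card
      = ∑ y ∈ S, (Finset.univ.filter fun g : G => g • y ∈ A).card := by
        rw [Finset.sum_congr rfl hconst, Finset.sum_const, smul_eq_mul]
    _ = ∑ g : G, (S.filter fun y => g • y ∈ A).card := by
        simp only [Finset.card_filter]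
        exact Finset.sum_comm
    _ = Fintype.card G * A.card := by simp [hfiber]

/-- Two functions with equally sized fibers differ by a permutation of their domain. -/
theorem exists_perm_of_card_fiber_eq {α β : Type*} [Fintype α] [DecidableEq β] (f g : α → β)
    (h : ∀ b, (Finset.univ.filter fun a => f a = b).card =
      (Finset.univ.filter fun a => g a = b).card) :
    ∃ σ : Equiv.Perm α, ∀ a, g (σ a) = f a := by
  let e : ∀ b, {a // f a = b} ≃ {a // g a = b} := fun b =>
    Fintype.equivOfCardEq (by rw [Fintype.card_subtype, Fintype.card_subtype, h])
  refine ⟨(Equiv.sigmaFiberEquiv f).symm.trans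
    ((Equiv.sigmaCongrRight fun b => e b).trans (Equiv.sigmaFiberEquiv g)), fun a => ?_⟩
  exact (e (f a) ⟨a, rfl⟩).2

open Pointwise

variable {n : ℕ}

/-- The pairs of disjoint subsets of `Fin n` of sizes `j` and `w`. -/
def disjointPairs (n j w : ℕ) : Finset (Finset (Fin n) × Finset (Fin n)) :=
  Finset.univ.filter fun p => p.1.card = j ∧ p.2.card = w ∧ Disjoint p.1 p.2

theorem mem_disjointPairs {j w : ℕ} {p : Finset (Fin n) × Finset (Fin n)} :
    p ∈ disjointPairs n j w ↔ p.1.card = j ∧ p.2.card = w ∧ Disjoint p.1 p.2 := by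
  simp [disjointPairs]

theorem card_filter_disjointPairs (j w : ℕ) (q : Finset (Fin n) × Finset (Fin n) → Prop)
    [DecidablePred q] :
    ((disjointPairs n j w).filter q).card = ∑ P ∈ Finset.univ.powersetCard j,
      ((Pᶜ.powersetCard w).filter fun W => q (P, W)).card := by
  rw [← Finset.card_sigma]
  refine Finset.card_bij (fun p _ => ⟨p.1, p.2⟩) ?_ ?_ ?_
  · rintro ⟨P, W⟩ h
    obtain ⟨h, hq⟩ := Finset.mem_filter.1 h
    obtain ⟨h1, h2, h3⟩ := mem_disjointPairs.1 h
    simp only [Finset.mem_sigma, Finset.mem_powersetCard, Finset.mem_filter]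
    exact ⟨⟨Finset.subset_univ _, h1⟩,
      ⟨Finset.subset_compl_iff_disjoint_right.2 h3.symm, h2⟩, hq⟩
  · rintro ⟨P, W⟩ _ ⟨P', W'⟩ _ h
    simpa using h
  · rintro ⟨P, W⟩ h
    simp only [Finset.mem_sigma, Finset.mem_powersetCard, Finset.mem_filter] at h
    obtain ⟨⟨_, h1⟩, ⟨h2, h3⟩, hq⟩ := h
    exact ⟨(P, W), Finset.mem_filter.2 ⟨mem_disjointPairs.2
      ⟨h1, h3, (Finset.subset_compl_iff_disjoint_right.1 h2).symm⟩, hq⟩, rfl⟩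

theorem card_disjointPairs (n j w : ℕ) :
    (disjointPairs n j w).card = n.choose j * (n - j).choose w := by
  have h := card_filter_disjointPairs (n := n) j w (fun _ => True)
  simp only [Finset.filter_true, Finset.card_powersetCard] at h
  rw [h, Finset.sum_congr rfl (g := fun _ => (n - j).choose w)]
  · simp
  · intro P hP
    rw [Finset.card_compl, (Finset.mem_powersetCard.1 hP).2, Fintype.card_fin]

theorem smul_mem_disjointPairs {j w : ℕ} (g : Equiv.Perm (Fin n))
    (p : Finset (Fin n) × Finset (Fin n)) (hp : p ∈ disjointPairs n j w) :
    g • p ∈ disjointPairs n j w := by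
  obtain ⟨h1, h2, h3⟩ := mem_disjointPairs.1 hp
  refine mem_disjointPairs.2 ⟨by simpa using h1, by simpa using h2, ?_⟩
  refine Finset.disjoint_left.2 fun x hx hx' => ?_
  rw [Prod.smul_fst, ← Finset.inv_smul_mem_iff] at hx
  rw [Prod.smul_snd, ← Finset.inv_smul_mem_iff] at hx'
  exact Finset.disjoint_left.1 h3 hx hx'

theorem exists_smul_eq_disjointPairs {j w : ℕ} (p : Finset (Fin n) × Finset (Fin n))
    (hp : p ∈ disjointPairs n j w) (p' : Finset (Fin n) × Finset (Fin n))
    (hp' : p' ∈ disjointPairs n j w) : ∃ g : Equiv.Perm (Fin n), g • p = p' := by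
  let color : Finset (Fin n) × Finset (Fin n) → Fin n → Bool × Bool :=
    fun p x => (decide (x ∈ p.1), decide (x ∈ p.2))
  have hcard : ∀ p ∈ disjointPairs n j w, ∀ b,
      (Finset.univ.filter fun x => color p x = b).card =
        match b with
        | (true, true) => 0
        | (true, false) => j
        | (false, true) => w
        | (false, false) => n - (j + w) := by
    intro p hp b
    obtain ⟨h1, h2, h3⟩ := mem_disjointPairs.1 hp
    have h4 : ∀ x ∈ p.1, x ∉ p.2 := fun _ => (Finset.disjoint_left.1 h3 ·)
    have h5 : ∀ x ∈ p.2, x ∉ p.1 := fun _ => (Finset.disjoint_right.1 h3 ·)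
    rcases b with ⟨_ | _, _ | _⟩
    · have h6 := Finset.card_compl (p.1 ∪ p.2)
      rw [Finset.card_union_of_disjoint h3, h1, h2, Fintype.card_fin] at h6
      rw [← h6]
      congr 1
      ext x
      simp [color]
    · rw [← h2]
      congr 1
      ext x
      simpa [color] using h5 x
    · rw [← h1]
      congr 1
      ext x
      simpa [color] using h4 x
    · rw [Finset.card_eq_zero, Finset.filter_eq_empty_iff]
      intro x _
      simpa [color] using h4 x
  obtain ⟨σ, hσ⟩ := exists_perm_of_card_fiber_eq (color p) (color p')
    fun b => (hcard p hp b).trans (hcard p' hp' b).symm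
  refine ⟨σ, Prod.ext ?_ ?_⟩
  · ext x
    have := congrArg Prod.fst (hσ (σ⁻¹ x))
    rw [Prod.smul_fst, ← Finset.inv_smul_mem_iff]
    simpa [color] using this.symm
  · ext x
    have := congrArg Prod.snd (hσ (σ⁻¹ x))
    rw [Prod.smul_snd, ← Finset.inv_smul_mem_iff]
    simpa [color] using this.symm

end Averaging

section Separation

open Pointwise

variable {n : ℕ}

/-- No member of `F` has the form `P ∪ {a, b}` with `a ∈ W` and `b` outside `P ∪ W`. -/
def Separated (F : Finset (Finset (Fin n))) (P W : Finset (Fin n)) : Prop :=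
  ∀ a ∈ W, ∀ b, b ∉ W → b ∉ P → insert a (insert b P) ∉ F

theorem separated_smul_iff {F : Finset (Finset (Fin n))} {P W : Finset (Fin n)}
    {g : Equiv.Perm (Fin n)} : Separated F (g • P) (g • W) ↔ Separated (g⁻¹ • F) P W := by
  constructor
  · intro h a ha b hbW hbP hab
    rw [Finset.mem_inv_smul_finset_iff, Finset.smul_finset_insert, Finset.smul_finset_insert] at hab
    exact h (g • a) (Finset.smul_mem_smul_finset ha) (g • b)
      (by rwa [Finset.smul_mem_smul_finset_iff]) (by rwa [Finset.smul_mem_smul_finset_iff]) hab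
  · intro h a ha b hbW hbP hab
    rw [← Finset.inv_smul_mem_iff] at ha hbW hbP
    refine h _ ha _ hbW hbP ?_
    rw [Finset.mem_inv_smul_finset_iff, Finset.smul_finset_insert, Finset.smul_finset_insert]
    simpa using hab

theorem Separated.compl {F : Finset (Finset (Fin n))} {P W : Finset (Fin n)}
    (h : Separated F P W) : Separated F P (Pᶜ \ W) := by
  intro a ha b hbW hbP hab
  simp only [Finset.mem_sdiff, Finset.mem_compl, not_and, not_not] at ha hbW
  rw [Finset.insert_comm] at hab
  exact h b (hbW hbP) a ha.2 ha.1 hab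

theorem IsCoveringSystem.exists_insert_mem {j : ℕ} {F : Finset (Finset (Fin n))}
    (hF : IsCoveringSystem n (j + 2) (j + 1) F) {P : Finset (Fin n)} (hP : P.card = j)
    {a : Fin n} (ha : a ∉ P) : ∃ b, b ≠ a ∧ b ∉ P ∧ insert a (insert b P) ∈ F := by
  obtain ⟨e, he, hsub⟩ := hF.2 (insert a P) (by rw [Finset.card_insert_of_notMem ha, hP])
  obtain ⟨b, hb⟩ : ∃ b, e \ insert a P = {b} := by
    rw [← Finset.card_eq_one, Finset.card_sdiff_of_subset hsub, hF.1 e he,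
      Finset.card_insert_of_notMem ha, hP]
    omega
  have hbm : b ∈ e \ insert a P := by simp [hb]
  simp only [Finset.mem_sdiff, Finset.mem_insert, not_or] at hbm
  refine ⟨b, hbm.2.1, hbm.2.2, ?_⟩
  have : e = insert a (insert b P) := by
    rw [Finset.insert_comm, ← Finset.singleton_union, ← hb,
      Finset.sdiff_union_of_subset hsub]
  exact this ▸ he

theorem IsCoveringSystem.inv_smul {r k : ℕ} {F : Finset (Finset (Fin n))}
    (hF : IsCoveringSystem n r k F) (g : Equiv.Perm (Fin n)) :
    IsCoveringSystem n r k (g⁻¹ • F) := by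
  refine ⟨fun e he => ?_, fun s hs => ?_⟩
  · rw [← hF.1 _ (Finset.mem_inv_smul_finset_iff.1 he), Finset.card_smul_finset]
  · obtain ⟨e, he, hse⟩ := hF.2 (g • s) (by rw [Finset.card_smul_finset, hs])
    exact ⟨g⁻¹ • e, Finset.smul_mem_smul_finset he, by rwa [Finset.subset_smul_finset_iff, inv_inv]⟩

theorem IsCoveringSystem.not_separated_singleton {j : ℕ} {F : Finset (Finset (Fin n))}
    (hF : IsCoveringSystem n (j + 2) (j + 1) F) {P : Finset (Fin n)} (hP : P.card = j)
    {a : Fin n} (ha : a ∉ P) : ¬ Separated F P {a} := by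
  obtain ⟨b, hba, hbP, hab⟩ := hF.exists_insert_mem hP ha
  exact fun h => h a (by simp) b (by simpa using hba) hbP hab

theorem IsCoveringSystem.card_separated_sq_le {j w : ℕ} {F : Finset (Finset (Fin n))}
    (hF : IsCoveringSystem n (j + 2) (j + 1) F) {P : Finset (Fin n)} (hP : P.card = j)
    (hw : w ≤ (n - j) / 2) [DecidablePred (Separated F P)] :
    ((Pᶜ.powersetCard w).filter (Separated F P)).card ^ 2 ≤ (w + 1) * (n - j).choose w := by
  let G : SimpleGraph (Fin n) :=
    { Adj := fun a b => a ≠ b ∧ a ∉ P ∧ b ∉ P ∧ insert a (insert b P) ∈ F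
      symm := ⟨fun a b h => ⟨h.1.symm, h.2.2.1, h.2.1, by rw [Finset.insert_comm]; exact h.2.2.2⟩⟩
      loopless := ⟨fun a h => h.1 rfl⟩ }
  have hc : Pᶜ.card = n - j := by rw [Finset.card_compl, hP, Fintype.card_fin]
  have := card_closed_sq_le G Pᶜ (w := w) ?_ ((Pᶜ.powersetCard w).filter (Separated F P)) ?_
  · rw [hc] at this
    exact this.trans (sum_range_choose_le hw)
  · intro a ha
    have ha := Finset.mem_compl.1 ha
    obtain ⟨b, hba, hbP, hab⟩ := hF.exists_insert_mem hP ha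
    exact ⟨b, hba.symm, ha, hbP, hab⟩
  · intro U hU
    obtain ⟨hU, hsep⟩ := Finset.mem_filter.1 hU
    obtain ⟨hUV, hUw⟩ := Finset.mem_powersetCard.1 hU
    refine ⟨hUV, hUw, fun a ha b hab => ?_⟩
    by_contra hb
    exact hsep a ha b hb hab.2.2.1 hab.2.2.2

end Separation

section RandomCopies

open Pointwise

variable {n : ℕ}

/-- Few permutations keep a given pair `(P, W)` separated by a covering system. -/
theorem IsCoveringSystem.sq_card_perm_separated_le {j w : ℕ} {F : Finset (Finset (Fin n))}
    (hF : IsCoveringSystem n (j + 2) (j + 1) F) (hj : j ≤ n) (hw : w ≤ (n - j) / 2)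
    {p : Finset (Fin n) × Finset (Fin n)} (hp : p ∈ disjointPairs n j w)
    [DecidablePred fun g : Equiv.Perm (Fin n) => Separated F (g • p.1) (g • p.2)] :
    (n - j).choose w *
        (Finset.univ.filter fun g : Equiv.Perm (Fin n) =>
          Separated F (g • p.1) (g • p.2)).card ^ 2 ≤
      (w + 1) * Fintype.card (Equiv.Perm (Fin n)) ^ 2 := by
  classical
  set A := (disjointPairs n j w).filter fun p => Separated F p.1 p.2 with hA
  set N := Fintype.card (Equiv.Perm (Fin n))
  have hB : 0 < (n - j).choose w := Nat.choose_pos (by omega)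
  have hM : 0 < n.choose j := Nat.choose_pos hj
  have hq := card_mul_card_filter_smul_mem (G := Equiv.Perm (Fin n)) (A := A)
    smul_mem_disjointPairs exists_smul_eq_disjointPairs (Finset.filter_subset _ _) hp
  have hset : (Finset.univ.filter fun g : Equiv.Perm (Fin n) => g • p ∈ A) =
      Finset.univ.filter fun g : Equiv.Perm (Fin n) => Separated F (g • p.1) (g • p.2) := by
    ext g
    simp [hA, smul_mem_disjointPairs g p hp]
  rw [hset, card_disjointPairs] at hq
  set q := (Finset.univ.filter fun g : Equiv.Perm (Fin n) =>
    Separated F (g • p.1) (g • p.2)).card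
  set B := (n - j).choose w
  have hAcard : A.card ≤ n.choose j * Nat.sqrt ((w + 1) * B) := by
    rw [hA, card_filter_disjointPairs]
    refine (Finset.sum_le_card_nsmul _ _ (Nat.sqrt ((w + 1) * B)) fun P hP => ?_).trans_eq
      (by simp)
    rw [Nat.le_sqrt']
    exact hF.card_separated_sq_le (Finset.mem_powersetCard.1 hP).2 hw
  have h1 : B * q ≤ N * Nat.sqrt ((w + 1) * B) := by
    refine Nat.le_of_mul_le_mul_left ?_ hM
    calc n.choose j * (B * q) = N * A.card := by rw [← mul_assoc, hq]
      _ ≤ N * (n.choose j * Nat.sqrt ((w + 1) * B)) := Nat.mul_le_mul_left _ hAcard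
      _ = n.choose j * (N * Nat.sqrt ((w + 1) * B)) := by ring
  refine Nat.le_of_mul_le_mul_left ?_ hB
  calc B * (B * q ^ 2) = (B * q) ^ 2 := by ring
    _ ≤ (N * Nat.sqrt ((w + 1) * B)) ^ 2 := Nat.pow_le_pow_left h1 2
    _ = N ^ 2 * Nat.sqrt ((w + 1) * B) ^ 2 := by ring
    _ ≤ N ^ 2 * ((w + 1) * B) := Nat.mul_le_mul_left _ (Nat.sqrt_le' _)
    _ = B * ((w + 1) * N ^ 2) := by ring

/-- The expected number of pairs `(P, W)` separated by four random copies of a covering system. -/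
theorem IsCoveringSystem.sum_card_separated_le {j w : ℕ} {F : Finset (Finset (Fin n))}
    (hF : IsCoveringSystem n (j + 2) (j + 1) F) (hj : j ≤ n) (hw : w ≤ (n - j) / 2)
    [∀ gs : Fin 4 → Equiv.Perm (Fin n), DecidablePred fun p : Finset (Fin n) × Finset (Fin n) =>
      ∀ i, Separated F (gs i • p.1) (gs i • p.2)] :
    ∑ gs : Fin 4 → Equiv.Perm (Fin n), (((disjointPairs n j w).filter fun p =>
        ∀ i, Separated F (gs i • p.1) (gs i • p.2)).card : ℚ) ≤
      Fintype.card (Fin 4 → Equiv.Perm (Fin n)) * n.choose j *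
        (((w : ℚ) + 1) ^ 2 / (n - j).choose w) := by
  classical
  have hB : (0 : ℚ) < (n - j).choose w := by
    exact_mod_cast Nat.choose_pos (show w ≤ n - j by omega)
  set N := Fintype.card (Equiv.Perm (Fin n)) with hN
  have hcount : ∀ p : Finset (Fin n) × Finset (Fin n),
      (Finset.univ.filter fun gs : Fin 4 → Equiv.Perm (Fin n) =>
        ∀ i, Separated F (gs i • p.1) (gs i • p.2)).card =
      (Finset.univ.filter fun g : Equiv.Perm (Fin n) =>
        Separated F (g • p.1) (g • p.2)).card ^ 4 := by
    intro p
    rw [← Fintype.card_piFinset_const]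
    congr 1
    ext gs
    simp [Fintype.mem_piFinset]
  have hswap : ∑ gs : Fin 4 → Equiv.Perm (Fin n), (((disjointPairs n j w).filter fun p =>
        ∀ i, Separated F (gs i • p.1) (gs i • p.2)).card : ℚ) =
      ∑ p ∈ disjointPairs n j w, ((Finset.univ.filter fun g : Equiv.Perm (Fin n) =>
        Separated F (g • p.1) (g • p.2)).card : ℚ) ^ 4 := by
    rw [← Nat.cast_sum]
    simp only [Finset.card_filter]
    rw [Finset.sum_comm]
    simp only [← Finset.card_filter, hcount]
    push_cast
    rfl
  have hbound : ∀ p ∈ disjointPairs n j w, ((Finset.univ.filter fun g : Equiv.Perm (Fin n) =>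
        Separated F (g • p.1) (g • p.2)).card : ℚ) ^ 4 ≤
      ((w : ℚ) + 1) ^ 2 * N ^ 4 / (n - j).choose w ^ 2 := by
    intro p hp
    rw [le_div_iff₀ (by positivity)]
    have h : ((n - j).choose w : ℚ) * ((Finset.univ.filter fun g : Equiv.Perm (Fin n) =>
        Separated F (g • p.1) (g • p.2)).card : ℚ) ^ 2 ≤ ((w : ℚ) + 1) * (N : ℚ) ^ 2 := by
      exact_mod_cast hF.sq_card_perm_separated_le hj hw hp
    have := pow_le_pow_left₀ (by positivity) h 2
    linarith
  rw [hswap]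
  refine (Finset.sum_le_card_nsmul _ _ _ hbound).trans_eq ?_
  rw [card_disjointPairs, nsmul_eq_mul, Fintype.card_fun, Fintype.card_fin, ← hN]
  push_cast
  field_simp

theorem sum_sq_div_choose_le {m j : ℕ} (hm : 10000 ≤ m) (hj : j + 1 ≤ 2 * m) :
    ∑ w ∈ Finset.Icc 2 (m / 2), ((w : ℚ) + 1) ^ 2 / m.choose w ≤ 1 / ((j : ℚ) + 1) := by
  have hm' : (10000 : ℚ) ≤ m := by exact_mod_cast hm
  have hj' : (j : ℚ) + 1 ≤ 2 * m := by exact_mod_cast hj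
  have hpow : ∀ r, r ≤ 5 → ((m : ℚ) / 2) ^ r ≤ r.factorial * m.choose r := by
    intro r hr
    have h1 : ((m + 1 - r : ℕ) ^ r : ℚ) ≤ r.factorial * m.choose r := by
      have := Nat.pow_le_choose (α := ℚ) r m
      rw [div_le_iff₀' (by positivity)] at this
      exact_mod_cast this
    refine (pow_le_pow_left₀ (by positivity) ?_ r).trans h1
    rw [Nat.cast_sub (by omega)]
    have : (r : ℚ) ≤ 5 := by exact_mod_cast hr
    push_cast
    linarith
  have h2 := hpow 2 (by norm_num)
  have h5 := hpow 5 (by norm_num)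
  norm_num [Nat.factorial] at h2 h5
  have hterm : ∀ w ∈ Finset.Icc 2 (m / 2), ((w : ℚ) + 1) ^ 2 / m.choose w ≤
      (if w ≤ 4 then 200 / (m : ℚ) ^ 2 else 0) + 3840 / (m : ℚ) ^ 3 := by
    intro w hw
    obtain ⟨hw2, hwm⟩ := Finset.mem_Icc.1 hw
    have hpos : (0 : ℚ) < m.choose w := by exact_mod_cast Nat.choose_pos (by omega)
    split_ifs with hw4
    · have hc : (m.choose 2 : ℚ) ≤ m.choose w := by
        exact_mod_cast choose_le_choose_of_le_half hw2 hwm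
      have hw4' : (w : ℚ) ≤ 4 := by exact_mod_cast hw4
      have : ((w : ℚ) + 1) ^ 2 / m.choose w ≤ 200 / (m : ℚ) ^ 2 := by
        rw [div_le_div_iff₀ hpos (by positivity)]
        have : ((w : ℚ) + 1) ^ 2 ≤ 25 := by nlinarith [(Nat.cast_nonneg w : (0 : ℚ) ≤ w)]
        calc ((w : ℚ) + 1) ^ 2 * (m : ℚ) ^ 2 ≤ 25 * (m : ℚ) ^ 2 := by gcongr
          _ ≤ 200 * (m.choose w : ℚ) := by linarith
      have h0 : (0 : ℚ) ≤ 3840 / (m : ℚ) ^ 3 := by positivity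
      linarith
    · have hc : (m.choose 5 : ℚ) ≤ m.choose w := by
        exact_mod_cast choose_le_choose_of_le_half (by omega) hwm
      have hwm' : (w : ℚ) + 1 ≤ m := by exact_mod_cast (show w + 1 ≤ m by omega)
      rw [zero_add, div_le_div_iff₀ hpos (by positivity)]
      calc ((w : ℚ) + 1) ^ 2 * (m : ℚ) ^ 3 ≤ (m : ℚ) ^ 2 * (m : ℚ) ^ 3 := by gcongr
        _ = 32 * ((m : ℚ) / 2) ^ 5 := by ring
        _ ≤ 3840 * (m.choose w : ℚ) := by linarith
  have hcard : ((Finset.Icc 2 (m / 2)).filter (· ≤ 4)).card ≤ 3 := by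
    refine (Finset.card_le_card (t := Finset.Icc 2 4) fun w hw => ?_).trans (by simp)
    simp only [Finset.mem_filter, Finset.mem_Icc] at hw ⊢
    omega
  calc ∑ w ∈ Finset.Icc 2 (m / 2), ((w : ℚ) + 1) ^ 2 / m.choose w
      ≤ ∑ w ∈ Finset.Icc 2 (m / 2),
          ((if w ≤ 4 then 200 / (m : ℚ) ^ 2 else 0) + 3840 / (m : ℚ) ^ 3) :=
        Finset.sum_le_sum hterm
    _ = ((Finset.Icc 2 (m / 2)).filter (· ≤ 4)).card * (200 / (m : ℚ) ^ 2) +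
          (Finset.Icc 2 (m / 2)).card * (3840 / (m : ℚ) ^ 3) := by
        rw [Finset.sum_add_distrib, ← Finset.sum_filter, Finset.sum_const, Finset.sum_const,
          nsmul_eq_mul, nsmul_eq_mul]
    _ ≤ 3 * (200 / (m : ℚ) ^ 2) + m * (3840 / (m : ℚ) ^ 3) := by
        gcongr
        · exact_mod_cast hcard
        · rw [Nat.card_Icc]
          omega
    _ = 4440 / (m : ℚ) ^ 2 := by
        field_simp
        ring
    _ ≤ 1 / (2 * m) := by
        rw [div_le_div_iff₀ (by positivity) (by positivity)]
        nlinarith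
    _ ≤ 1 / ((j : ℚ) + 1) := by gcongr

/-- Four suitable copies of a covering system have connected links at all but a `1 / (j + 1)`
fraction of the sets of size `j`. -/
theorem IsCoveringSystem.exists_copies {j : ℕ} {F : Finset (Finset (Fin n))}
    (hF : IsCoveringSystem n (j + 2) (j + 1) F) (hm : 10000 ≤ n - j) (hj : j + 1 ≤ 2 * (n - j)) :
    ∃ (H : Fin 4 → Finset (Finset (Fin n))) (𝓑 : Finset (Finset (Fin n))),
      (∀ i, (H i).card = F.card ∧ ∀ S ∈ H i, S.card = j + 2) ∧
      (∀ P ∈ 𝓑, P.card = j) ∧ (j + 1) * 𝓑.card ≤ n.choose j ∧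
      ∀ P : Finset (Fin n), P.card = j → P ∉ 𝓑 → ∀ W, Disjoint P W → W.Nonempty →
        (∃ b, b ∉ W ∧ b ∉ P) → ∃ i, ¬ Separated (H i) P W := by
  classical
  let X : (Fin 4 → Equiv.Perm (Fin n)) → ℕ → Finset (Finset (Fin n) × Finset (Fin n)) :=
    fun gs w => (disjointPairs n j w).filter fun p => ∀ i, Separated F (gs i • p.1) (gs i • p.2)
  obtain ⟨gs, -, hgs⟩ : ∃ gs ∈ (Finset.univ : Finset (Fin 4 → Equiv.Perm (Fin n))),
      ∑ w ∈ Finset.Icc 2 ((n - j) / 2), ((X gs w).card : ℚ) ≤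
        n.choose j * (1 / ((j : ℚ) + 1)) := by
    refine Finset.exists_le_of_sum_le Finset.univ_nonempty ?_
    rw [Finset.sum_comm, Finset.sum_const, nsmul_eq_mul, Finset.card_univ]
    refine (Finset.sum_le_sum fun w hw =>
      hF.sum_card_separated_le (by omega) (Finset.mem_Icc.1 hw).2).trans ?_
    rw [← Finset.mul_sum, ← mul_assoc]
    exact mul_le_mul_of_nonneg_left (sum_sq_div_choose_le hm hj) (by positivity)
  refine ⟨fun i => (gs i)⁻¹ • F,
    (Finset.Icc 2 ((n - j) / 2)).biUnion fun w => (X gs w).image Prod.fst,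
    fun i => ⟨Finset.card_smul_finset _ _, (hF.inv_smul (gs i)).1⟩, ?_, ?_, ?_⟩
  · intro P hP
    simp only [Finset.mem_biUnion, Finset.mem_image] at hP
    obtain ⟨w, -, p, hp, rfl⟩ := hP
    exact (mem_disjointPairs.1 (Finset.mem_filter.1 hp).1).1
  · have hle : (((Finset.Icc 2 ((n - j) / 2)).biUnion fun w => (X gs w).image Prod.fst).card : ℚ) ≤
        n.choose j * (1 / ((j : ℚ) + 1)) := by
      refine le_trans ?_ hgs
      exact_mod_cast Finset.card_biUnion_le.trans
        (Finset.sum_le_sum fun w _ => Finset.card_image_le)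
    rw [mul_one_div, le_div_iff₀ (by positivity)] at hle
    rw [mul_comm]
    exact_mod_cast hle
  · intro P hP hPB
    have small : ∀ W, Disjoint P W → W.Nonempty → W.card ≤ (n - j) / 2 →
        ∃ i, ¬ Separated ((gs i)⁻¹ • F) P W := by
      intro W hPW hW hWc
      by_contra! hsep
      have hW2 : W.card ≠ 1 := by
        intro h
        obtain ⟨a, rfl⟩ := Finset.card_eq_one.1 h
        exact (hF.inv_smul (gs 0)).not_separated_singleton hP
          (Finset.disjoint_singleton_right.1 hPW) (hsep 0)
      have := Finset.card_pos.2 hW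
      refine hPB (Finset.mem_biUnion.2 ⟨W.card, Finset.mem_Icc.2 ⟨by omega, hWc⟩,
        Finset.mem_image.2 ⟨(P, W), Finset.mem_filter.2 ⟨mem_disjointPairs.2 ⟨hP, rfl, hPW⟩,
          fun i => separated_smul_iff.2 (hsep i)⟩, rfl⟩⟩)
    intro W hPW hW ⟨b, hbW, hbP⟩
    rcases le_or_gt W.card ((n - j) / 2) with h | h
    · exact small W hPW hW h
    · obtain ⟨i, hi⟩ := small (Pᶜ \ W)
        (Finset.disjoint_of_subset_right Finset.sdiff_subset disjoint_compl_right)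
        ⟨b, by simp [hbW, hbP]⟩ (by
          rw [Finset.card_sdiff_of_subset (Finset.subset_compl_iff_disjoint_right.2 hPW.symm),
            Finset.card_compl, hP, Fintype.card_fin]
          omega)
      exact ⟨i, fun hs => hi hs.compl⟩

end RandomCopies

section SmallSystem

variable {n : ℕ}

theorem exists_isCoveringSystem_card_eq_coverNum {j : ℕ} (hj : j + 2 ≤ n) :
    ∃ F, IsCoveringSystem n (j + 2) (j + 1) F ∧ F.card = coverNum n (j + 2) (j + 1) := by
  refine Nat.sInf_mem (s := {m | ∃ F, IsCoveringSystem n (j + 2) (j + 1) F ∧ F.card = m})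
    ⟨_, Finset.univ.powersetCard (j + 2), ⟨fun e he => (Finset.mem_powersetCard.1 he).2, ?_⟩, rfl⟩
  intro s hs
  obtain ⟨e, hse, -, he⟩ := Finset.exists_subsuperset_card_eq (Finset.subset_univ s)
    (show s.card ≤ j + 2 by omega) (by simpa using hj)
  exact ⟨e, Finset.mem_powersetCard.2 ⟨Finset.subset_univ _, he⟩, hse⟩

theorem IsCoveringSystem.choose_le {j : ℕ} {F : Finset (Finset (Fin n))}
    (hF : IsCoveringSystem n (j + 2) (j + 1) F) : n.choose (j + 1) ≤ (j + 2) * F.card := by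
  have hsub : Finset.univ.powersetCard (j + 1) ⊆ F.biUnion fun e => e.powersetCard (j + 1) := by
    intro s hs
    obtain ⟨e, he, hse⟩ := hF.2 s (Finset.mem_powersetCard.1 hs).2
    exact Finset.mem_biUnion.2 ⟨e, he, Finset.mem_powersetCard.2
      ⟨hse, (Finset.mem_powersetCard.1 hs).2⟩⟩
  have := (Finset.card_le_card hsub).trans (Finset.card_biUnion_le_card_mul _ _ (j + 2) ?_)
  · rw [Finset.card_powersetCard, Finset.card_univ, Fintype.card_fin] at this
    linarith
  · intro e he
    rw [Finset.card_powersetCard, hF.1 e he, Nat.choose_succ_self_right]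

/-- All pairs `(S, x)` with `x ∈ S ∈ H`. -/
def allHeads (H : Finset (Finset (Fin n))) : Finset (Finset (Fin n) × Fin n) :=
  H.biUnion fun S => S.image fun x => (S, x)

theorem mem_allHeads {H : Finset (Finset (Fin n))} {p : Finset (Fin n) × Fin n} :
    p ∈ allHeads H ↔ p.1 ∈ H ∧ p.2 ∈ p.1 := by
  simp only [allHeads, Finset.mem_biUnion, Finset.mem_image]
  constructor
  · rintro ⟨S, hS, x, hx, rfl⟩
    exact ⟨hS, hx⟩
  · rintro ⟨h1, h2⟩
    exact ⟨p.1, h1, p.2, h2, rfl⟩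

/-- Pairs connecting the link at `P` by arcs from `v` to all other vertices and back. -/
def linkStar (P : Finset (Fin n)) (v : Fin n) : Finset (Finset (Fin n) × Fin n) :=
  (Pᶜ.erase v).image (fun u => (insert u (insert v P), u)) ∪
    (Pᶜ.erase v).image fun u => (insert u (insert v P), v)

theorem mem_linkStar {P : Finset (Fin n)} {v : Fin n} {p : Finset (Fin n) × Fin n} :
    p ∈ linkStar P v ↔ ∃ u, u ≠ v ∧ u ∉ P ∧ p.1 = insert u (insert v P) ∧ (p.2 = u ∨ p.2 = v) := by
  simp only [linkStar, Finset.mem_union, Finset.mem_image, Finset.mem_erase, Finset.mem_compl]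
  constructor
  · rintro (⟨u, ⟨h1, h2⟩, rfl⟩ | ⟨u, ⟨h1, h2⟩, rfl⟩)
    · exact ⟨u, h1, h2, rfl, .inl rfl⟩
    · exact ⟨u, h1, h2, rfl, .inr rfl⟩
  · rintro ⟨u, h1, h2, h3, h4 | h4⟩
    · exact .inl ⟨u, ⟨h1, h2⟩, Prod.ext h3.symm h4.symm⟩
    · exact .inr ⟨u, ⟨h1, h2⟩, Prod.ext h3.symm h4.symm⟩

theorem card_linkStar_le (P : Finset (Fin n)) (v : Fin n) :
    (linkStar P v).card ≤ 2 * (n - P.card) := by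
  have h : (Pᶜ.erase v).card ≤ n - P.card := by
    refine (Finset.card_le_card (Finset.erase_subset _ _)).trans_eq ?_
    rw [Finset.card_compl, Fintype.card_fin]
  refine (Finset.card_union_le _ _).trans ?_
  rw [two_mul]
  exact add_le_add (Finset.card_image_le.trans h) (Finset.card_image_le.trans h)

theorem exists_small_system {j : ℕ} (hm : 10000 ≤ n - j) (hj : j + 1 ≤ 2 * (n - j)) :
    ∃ E : Finset (Finset (Fin n) × Fin n), IsHornSystem j E ∧ LinksConnected j E ∧
      E.card ≤ 6 * (j + 2) * coverNum n (j + 2) (j + 1) := by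
  classical
  obtain ⟨F, hF, hFc⟩ := exists_isCoveringSystem_card_eq_coverNum (n := n) (j := j) (by omega)
  obtain ⟨H, 𝓑, hH, h𝓑, h𝓑c, hconn⟩ := hF.exists_copies hm hj
  have hv : ∀ P ∈ 𝓑, ∃ v, v ∉ P := by
    intro P hP
    by_contra! h
    have h1 := Finset.card_le_card (show Finset.univ ⊆ P from fun x _ => h x)
    rw [Finset.card_univ, Fintype.card_fin, h𝓑 P hP] at h1
    omega
  have : Nonempty (Fin n) := ⟨⟨0, by omega⟩⟩
  choose! c hc using hv
  refine ⟨(Finset.univ.biUnion fun i => allHeads (H i)) ∪ 𝓑.biUnion fun P => linkStar P (c P),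
    ?_, ?_, ?_⟩
  · intro p hp
    simp only [Finset.mem_union, Finset.mem_biUnion, Finset.mem_univ, true_and, mem_allHeads,
      mem_linkStar] at hp
    rcases hp with ⟨i, h1, h2⟩ | ⟨P, hP, u, huv, huP, h1, h2⟩
    · exact ⟨h2, (hH i).2 _ h1⟩
    · refine ⟨?_, ?_⟩
      · rcases h2 with h2 | h2 <;> simp [h1, h2]
      · rw [h1, card_insert_insert_of_notMem huv huP (hc P hP), h𝓑 P hP]
  · intro P hP W hPW hW hout
    simp only [Finset.mem_union, Finset.mem_biUnion, Finset.mem_univ, true_and, mem_allHeads,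
      mem_linkStar]
    by_cases hPB : P ∈ 𝓑
    · obtain ⟨a, ha⟩ := hW
      obtain ⟨b, hbW, hbP⟩ := hout
      by_cases hcW : c P ∈ W
      · refine ⟨c P, hcW, b, hbW, hbP, .inr ⟨P, hPB, b, ?_, hbP, Finset.insert_comm _ _ _, .inl rfl⟩⟩
        rintro rfl
        exact hbW hcW
      · refine ⟨a, ha, c P, hcW, hc P hPB, .inr ⟨P, hPB, a, ?_, ?_, rfl, .inr rfl⟩⟩
        · rintro rfl
          exact hcW ha
        · exact fun h => Finset.disjoint_left.1 hPW h ha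
    · obtain ⟨i, hi⟩ := hconn P hP hPB W hPW hW hout
      simp only [Separated, not_forall, not_not] at hi
      obtain ⟨a, ha, b, hbW, hbP, hab⟩ := hi
      exact ⟨a, ha, b, hbW, hbP, .inl ⟨i, hab, by simp⟩⟩
  · have h1 : ∀ i, (allHeads (H i)).card ≤ (j + 2) * F.card := by
      intro i
      refine (Finset.card_biUnion_le_card_mul _ _ (j + 2) fun S hS => ?_).trans_eq ?_
      · exact Finset.card_image_le.trans_eq ((hH i).2 S hS)
      · rw [(hH i).1, mul_comm]
    have h2 : (Finset.univ.biUnion fun i => allHeads (H i)).card ≤ 4 * ((j + 2) * F.card) :=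
      (Finset.card_biUnion_le_card_mul _ _ _ fun i _ => h1 i).trans_eq (by simp)
    have h3 : (𝓑.biUnion fun P => linkStar P (c P)).card ≤ 𝓑.card * (2 * (n - j)) :=
      Finset.card_biUnion_le_card_mul _ _ _ fun P hP =>
        (card_linkStar_le P (c P)).trans_eq (by rw [h𝓑 P hP])
    have h4 : 𝓑.card * (n - j) ≤ n.choose (j + 1) := by
      refine Nat.le_of_mul_le_mul_left ?_ (Nat.succ_pos j)
      calc (j + 1) * (𝓑.card * (n - j)) = ((j + 1) * 𝓑.card) * (n - j) := by ring
        _ ≤ n.choose j * (n - j) := Nat.mul_le_mul_right _ h𝓑c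
        _ = (j + 1) * n.choose (j + 1) := by rw [← Nat.choose_succ_right_eq, mul_comm]
    have h5 := hF.choose_le
    have h6 := Finset.card_union_le (Finset.univ.biUnion fun i => allHeads (H i))
      (𝓑.biUnion fun P => linkStar P (c P))
    rw [← hFc]
    linarith

end SmallSystem

/-- For every integer constant `c ≥ 0` there exists `n₀` such that for every
`n ≥ n₀` and every integer `k` with `|2k − n| ≤ c`, there is a ucp-irredundant CNF formula
`φℓ` on `n` variables with `|φℓ| = (k+1)·binom(n−1, k)`, and a CNF formula `φ*`
ucp-equivalent to `φℓ` with `|φ*| ≤ 6·(k+1)·C(n, k+1, k)`. -/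
theorem separation_ucp_irredundant :
    ∀ c : ℕ, ∃ n₀ : ℕ, ∀ n : ℕ, n₀ ≤ n → ∀ k : ℕ, |2 * (k : ℤ) - (n : ℤ)| ≤ (c : ℤ) →
      ∃ φℓ φstar : CnfFormula n,
        (∀ C ∈ φℓ, Clause.Wf C) ∧ (∀ C ∈ φstar, Clause.Wf C) ∧
        UcpIrredundant φℓ ∧
        φℓ.card = (k + 1) * Nat.choose (n - 1) k ∧
        UcpEquiv φℓ φstar ∧
        φstar.card ≤ 6 * (k + 1) * coverNum n (k + 1) k := by
  intro c
  refine ⟨20000 + 4 * c, fun n hn k hk => ?_⟩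
  obtain ⟨hk1, hk2⟩ := abs_le.1 hk
  obtain ⟨j, rfl⟩ : ∃ j, k = j + 1 := ⟨k - 1, by omega⟩
  obtain ⟨E, hE, hEc, hcard⟩ := exists_small_system (n := n) (j := j) (by omega) (by omega)
  let z : Fin n := ⟨0, by omega⟩
  refine ⟨hornFormula (pinnedSystem j z), hornFormula E, hornFormula_wf _, hornFormula_wf _,
    ucpIrredundant_pinnedSystem j z, card_hornFormula_pinnedSystem j z, ?_, ?_⟩
  · exact ucpEquiv_hornFormula (isHornSystem_pinnedSystem j z) (linksConnected_pinnedSystem j z)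
      hE hEc
  · exact Finset.card_image_le.trans hcard
end

section
/- Assume φ ⊆ Ψ_{n,k} (with 1 ≤ k ≤ n−1), let A ⊆ X be a (k−1)-element set of variables, let α be the partial assignment consisting of the positive literals on A, and let x_ℓ ∈ X∖A. Then for β ∈ {x_ℓ, ¬x_ℓ}, UCP(φ ∪ α ∪ {β}) ≠ {⊥}; moreover UCP(φ ∪ α ∪ {¬x_ℓ}) equals α together with exactly the negative literals ¬x_i for those x_i ∈ X∖A such that the directed graph G^d(φ, A) contains a directed path (possibly of length 0) from x_i to x_ℓ; and UCP(φ ∪ α ∪ {x_ℓ}) contains α together with at least the positive literals x_i for those x_i ∈ X∖A such that G^d(φ, A) contains a directed path (possibly of length 0) from x_ℓ to x_i. -/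
instance {n : ℕ} (C : Clause n) : Decidable (Clause.Wf C) :=
  decidable_of_iff (∀ l ∈ C, ∀ l' ∈ C, l.1 = l'.1 → l = l') Iff.rfl

/-- `Ψ_{n,k}`: the CNF formula on `x₁, …, xₙ` consisting of all clauses (on pairwise
distinct variables) containing exactly `k` negative literals and one positive literal. -/
def Psi (n k : ℕ) : CnfFormula n :=
  Finset.univ.filter (fun C : Clause n =>
    Clause.Wf C ∧ (C.filter (fun l => l.2 = false)).card = k ∧
      (C.filter (fun l => l.2 = true)).card = 1)

/-- `neg(A)`: the set of negative literals on the variables in `A`. -/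
def negVars {n : ℕ} (A : Finset (Fin n)) : Finset (Lit n) := A.image (fun x => (x, false))

/-- The set of positive literals on the variables in `A`. -/
def posVars {n : ℕ} (A : Finset (Fin n)) : Finset (Lit n) := A.image (fun x => (x, true))

/-- The directed graph `G^d(φ, A)` on `X ∖ A`: directed edge `(x_i, x_j)` whenever
`neg(A) ∪ {¬x_i, x_j} ∈ φ`. -/
def GdEdge {n : ℕ} (φ : CnfFormula n) (A : Finset (Fin n)) (i j : Fin n) : Prop :=
  insert ((i, false) : Lit n) (insert ((j, true) : Lit n) (negVars A)) ∈ φ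

theorem mem_negVars {n : ℕ} {A : Finset (Fin n)} {l : Lit n} :
    l ∈ negVars A ↔ l.1 ∈ A ∧ l.2 = false := by
  obtain ⟨i, b⟩ := l
  simp [negVars, eq_comm]

theorem mem_posVars {n : ℕ} {A : Finset (Fin n)} {l : Lit n} :
    l ∈ posVars A ↔ l.1 ∈ A ∧ l.2 = true := by
  obtain ⟨i, b⟩ := l
  simp [posVars, eq_comm]

theorem card_negVars {n : ℕ} (A : Finset (Fin n)) : (negVars A).card = A.card :=
  Finset.card_image_of_injective _ fun _ _ h => congrArg Prod.fst h

theorem mem_unitClauses {n : ℕ} {α : Finset (Lit n)} {C : Clause n} :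
    C ∈ unitClauses α ↔ ∃ l ∈ α, C = {l} := by
  simp [unitClauses, eq_comm]

/-- Every literal of the assignment is derived. -/
theorem ucpDeriv_of_mem {n : ℕ} {φ : CnfFormula n} {α : Finset (Lit n)} {l : Lit n}
    (hl : l ∈ α) : UcpDeriv (φ ∪ unitClauses α) l :=
  .step {l} (Finset.mem_union_right _ (mem_unitClauses.2 ⟨l, hl, rfl⟩)) l (by simp) (by simp)

theorem exists_pos_of_mem_Psi {n k : ℕ} {C : Clause n} (hC : C ∈ Psi n k) :
    ∃ j, ∀ l : Lit n, l ∈ C ∧ l.2 = true ↔ l = (j, true) := by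
  obtain ⟨p, hp⟩ := Finset.card_eq_one.1 (Finset.mem_filter.1 hC).2.2.2
  have h (l : Lit n) : l ∈ C ∧ l.2 = true ↔ l = p := by
    rw [← Finset.mem_singleton (a := p), ← hp, Finset.mem_filter]
  have hp2 : p.2 = true := ((h p).2 rfl).2
  exact ⟨p.1, fun l => by rw [h, ← hp2]⟩

/-- The negative literals of a clause of `Ψ_{n,k}` do not fit into fewer than `k` variables. -/
theorem exists_neg_notMem_of_mem_Psi {n k : ℕ} {C : Clause n} (hC : C ∈ Psi n k)
    {A : Finset (Fin n)} (hA : A.card < k) : ∃ i ∉ A, ((i, false) : Lit n) ∈ C := by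
  by_contra! h
  have hsub : C.filter (fun l => l.2 = false) ⊆ negVars A := by
    rintro ⟨i, b⟩ hl
    obtain ⟨hl, rfl⟩ := Finset.mem_filter.1 hl
    exact mem_negVars.2 ⟨by_contra fun hi => h i hi hl, rfl⟩
  have := Finset.card_le_card hsub
  rw [card_negVars, (Finset.mem_filter.1 hC).2.2.1] at this
  omega

/-- A clause of `Ψ_{n,k}` whose negative literals other than `¬x_i` are all on `A` is the
clause of an edge of `G^d` leaving `x_i`. -/
theorem eq_insert_negVars_of_mem_Psi {n k : ℕ} {C : Clause n} (hC : C ∈ Psi n k)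
    {A : Finset (Fin n)} (hA : A.card + 1 = k) {i : Fin n} (hi : (i, false) ∈ C)
    (h : ∀ m, m ≠ i → ((m, false) : Lit n) ∈ C → m ∈ A) :
    i ∉ A ∧ ∃ j, C = insert ((i, false) : Lit n) (insert ((j, true) : Lit n) (negVars A)) := by
  have heq : (C.filter (fun l => l.2 = false)).erase (i, false) = negVars A := by
    refine Finset.eq_of_subset_of_card_le ?_ ?_
    · rintro ⟨m, b⟩ hm
      simp only [Finset.mem_erase, Finset.mem_filter] at hm
      obtain ⟨hne, hm, rfl⟩ := hm
      exact mem_negVars.2 ⟨h m (fun e => hne (by rw [e])) hm, rfl⟩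
    · rw [Finset.card_erase_of_mem (by simpa using hi), (Finset.mem_filter.1 hC).2.2.1,
        card_negVars]
      omega
  obtain ⟨j, hj⟩ := exists_pos_of_mem_Psi hC
  refine ⟨fun hiA => ?_, j, ?_⟩
  · have : ((i, false) : Lit n) ∈ negVars A := mem_negVars.2 ⟨hiA, rfl⟩
    simp [← heq] at this
  · ext ⟨m, b⟩
    cases b
    · simp only [← heq, Finset.mem_insert, Finset.mem_erase, Finset.mem_filter]
      by_cases hm : m = i
      · simp [hm, hi]
      · simp [hm]
    · simpa [mem_negVars] using hj (m, true)

/-- If `¬x_ℓ` is assigned, only literals of `α` and literals `¬x_i` with `x_i` reaching `x_ℓ`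
are derived. -/
theorem mem_of_ucpDeriv_neg {n k : ℕ} {φ : CnfFormula n} (hφ : φ ⊆ Psi n k)
    {A : Finset (Fin n)} (hA : A.card + 1 = k) {ℓ : Fin n} (hℓ : ℓ ∉ A) {l : Lit n}
    (hl : UcpDeriv (φ ∪ unitClauses (insert ((ℓ, false) : Lit n) (posVars A))) l) :
    (l.1 ∈ A ∧ l.2 = true) ∨
      (l.2 = false ∧ l.1 ∉ A ∧ Relation.ReflTransGen (GdEdge φ A) l.1 ℓ) := by
  induction hl with
  | step C hC l hl h ih =>
    rcases Finset.mem_union.1 hC with hC | hC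
    · have hneg (m : Fin n) (hm : ((m, false) : Lit n) ∈ C) (hne : (m, false) ≠ l) : m ∈ A := by
        simpa [negLit] using ih (m, false) (Finset.mem_erase.2 ⟨hne, hm⟩)
      obtain ⟨i, b⟩ := l
      cases b
      · obtain ⟨hi, j, rfl⟩ := eq_insert_negVars_of_mem_Psi (hφ hC) hA hl
          fun m hm hmC => hneg m hmC (by simpa using hm)
        have hj := ih (j, true) (by simp)
        simp only [negLit, Bool.not_true, Bool.false_eq_true, and_false, false_or, true_and] at hj
        exact Or.inr ⟨rfl, hi, .head hC hj.2⟩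
      · obtain ⟨m, hmA, hm⟩ := exists_neg_notMem_of_mem_Psi (hφ hC) (A := A) (by omega)
        exact absurd (hneg m hm (by simp)) hmA
    · obtain ⟨l', hl', rfl⟩ := mem_unitClauses.1 hC
      obtain rfl := Finset.mem_singleton.1 hl
      rcases Finset.mem_insert.1 hl' with rfl | hl'
      · exact Or.inr ⟨rfl, hℓ, .refl⟩
      · exact Or.inl (mem_posVars.1 hl')

/-- If every assigned literal is positive, every derived literal is positive. -/
theorem pos_of_ucpDeriv {n k : ℕ} {φ : CnfFormula n} (hφ : φ ⊆ Psi n k)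
    {α : Finset (Lit n)} (hα : ∀ l ∈ α, l.2 = true) {l : Lit n}
    (hl : UcpDeriv (φ ∪ unitClauses α) l) : l.2 = true := by
  induction hl with
  | step C hC l hl h ih =>
    rcases Finset.mem_union.1 hC with hC | hC
    · obtain ⟨j, hj⟩ := exists_pos_of_mem_Psi (hφ hC)
      by_cases hlj : (j, true) = l
      · rw [← hlj]
      · simpa [negLit] using ih (j, true) (Finset.mem_erase.2 ⟨hlj, ((hj _).2 rfl).1⟩)
    · obtain ⟨l', hl', rfl⟩ := mem_unitClauses.1 hC
      obtain rfl := Finset.mem_singleton.1 hl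
      exact hα l hl'

theorem not_ucpBot_of_pos {n k : ℕ} {φ : CnfFormula n} (hφ : φ ⊆ Psi n k)
    {α : Finset (Lit n)} (hα : ∀ l ∈ α, l.2 = true) : ¬ UcpBot (φ ∪ unitClauses α) := by
  rintro ⟨C, hC, h⟩
  obtain ⟨l, hl, hl2⟩ : ∃ l ∈ C, l.2 = true := by
    rcases Finset.mem_union.1 hC with hC | hC
    · obtain ⟨j, hj⟩ := exists_pos_of_mem_Psi (hφ hC)
      exact ⟨_, (hj _).2 rfl⟩
    · obtain ⟨l, hl, rfl⟩ := mem_unitClauses.1 hC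
      exact ⟨l, by simp, hα l hl⟩
  have := pos_of_ucpDeriv hφ hα (h l hl)
  simp [negLit, hl2] at this

theorem not_ucpBot_neg {n k : ℕ} {φ : CnfFormula n} (hφ : φ ⊆ Psi n k)
    {A : Finset (Fin n)} (hA : A.card + 1 = k) {ℓ : Fin n} (hℓ : ℓ ∉ A) :
    ¬ UcpBot (φ ∪ unitClauses (insert ((ℓ, false) : Lit n) (posVars A))) := by
  rintro ⟨C, hC, h⟩
  rcases Finset.mem_union.1 hC with hC | hC
  · obtain ⟨m, hmA, hm⟩ := exists_neg_notMem_of_mem_Psi (hφ hC) (A := A) (by omega)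
    have := mem_of_ucpDeriv_neg hφ hA hℓ (h _ hm)
    simp [negLit, hmA] at this
  · obtain ⟨l, hl, rfl⟩ := mem_unitClauses.1 hC
    have := mem_of_ucpDeriv_neg hφ hA hℓ (h l (by simp))
    rcases Finset.mem_insert.1 hl with rfl | hl
    · simp [negLit, hℓ] at this
    · simp [negLit, mem_posVars.1 hl] at this

/-- Propagation backwards along paths of `G^d` ending in a refuted vertex. -/
theorem ucpDeriv_neg_of_path {n : ℕ} {φ ψ : CnfFormula n} (hψ : φ ⊆ ψ) {A : Finset (Fin n)}
    (hA : ∀ a ∈ A, UcpDeriv ψ (a, true)) {i ℓ : Fin n} (hℓ : UcpDeriv ψ (ℓ, false))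
    (h : Relation.ReflTransGen (GdEdge φ A) i ℓ) : UcpDeriv ψ (i, false) := by
  induction h using Relation.ReflTransGen.head_induction_on with
  | refl => exact hℓ
  | head hij _ ih =>
    refine .step _ (hψ hij) _ (by simp) ?_
    rintro ⟨m, b⟩ hm
    simp only [Finset.mem_erase, Finset.mem_insert, mem_negVars, ne_eq] at hm
    rcases hm with ⟨hne, hm | hm | ⟨hm, rfl⟩⟩
    · exact absurd hm hne
    · rw [hm]
      exact ih
    · exact hA m hm

/-- Propagation forwards along paths of `G^d` starting in a satisfied vertex. -/
theorem ucpDeriv_pos_of_path {n : ℕ} {φ ψ : CnfFormula n} (hψ : φ ⊆ ψ) {A : Finset (Fin n)}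
    (hA : ∀ a ∈ A, UcpDeriv ψ (a, true)) {i ℓ : Fin n} (hℓ : UcpDeriv ψ (ℓ, true))
    (h : Relation.ReflTransGen (GdEdge φ A) ℓ i) : UcpDeriv ψ (i, true) := by
  induction h with
  | refl => exact hℓ
  | tail _ hij ih =>
    refine .step _ (hψ hij) _ (by simp) ?_
    rintro ⟨m, b⟩ hm
    simp only [Finset.mem_erase, Finset.mem_insert, mem_negVars, ne_eq] at hm
    rcases hm with ⟨hne, hm | hm | ⟨hm, rfl⟩⟩
    · rw [hm]
      exact ih
    · exact absurd hm hne
    · exact hA m hm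

/-- Let `φ ⊆ Ψ_{n,k}` (with `1 ≤ k ≤ n−1`), `A ⊆ X` a `(k−1)`-element set of
variables, `α` the partial assignment of the positive literals on `A`, and `x_ℓ ∈ X∖A`.
Then for `β ∈ {x_ℓ, ¬x_ℓ}`, `UCP(φ ∪ α ∪ {β}) ≠ {⊥}`; `UCP(φ ∪ α ∪ {¬x_ℓ})` equals `α`
together with exactly the negative literals `¬x_i` for `x_i ∈ X∖A` with a directed path
(possibly of length 0) from `x_i` to `x_ℓ` in `G^d(φ, A)`; and `UCP(φ ∪ α ∪ {x_ℓ})`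
contains `α` together with at least the positive literals `x_i` for `x_i ∈ X∖A` with a
directed path (possibly of length 0) from `x_ℓ` to `x_i` in `G^d(φ, A)`. -/
theorem ucp_characterized_by_Gd {n k : ℕ} (hk : 1 ≤ k) (hkn : k + 1 ≤ n)
    (φ : CnfFormula n) (hφ : φ ⊆ Psi n k)
    (A : Finset (Fin n)) (hA : A.card + 1 = k) (ℓ : Fin n) (hℓ : ℓ ∉ A) :
    (∀ β : Lit n, β = (ℓ, true) ∨ β = (ℓ, false) →
      ¬ UcpBot (φ ∪ unitClauses (insert β (posVars A)))) ∧
    (UcpSet (φ ∪ unitClauses (insert ((ℓ, false) : Lit n) (posVars A))) =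
      ↑(posVars A) ∪
        {l : Lit n | l.2 = false ∧ l.1 ∉ A ∧ Relation.ReflTransGen (GdEdge φ A) l.1 ℓ}) ∧
    (↑(posVars A) ∪
        {l : Lit n | l.2 = true ∧ l.1 ∉ A ∧ Relation.ReflTransGen (GdEdge φ A) ℓ l.1} ⊆
      UcpSet (φ ∪ unitClauses (insert ((ℓ, true) : Lit n) (posVars A)))) := by
  have hmem (β : Lit n) (a : Fin n) (ha : a ∈ A) :
      UcpDeriv (φ ∪ unitClauses (insert β (posVars A))) (a, true) :=
    ucpDeriv_of_mem (Finset.mem_insert_of_mem (mem_posVars.2 ⟨ha, rfl⟩))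
  refine ⟨?_, Set.Subset.antisymm ?_ ?_, ?_⟩
  · rintro β (rfl | rfl)
    · refine not_ucpBot_of_pos hφ fun l hl => ?_
      rcases Finset.mem_insert.1 hl with rfl | hl
      · rfl
      · exact (mem_posVars.1 hl).2
    · exact not_ucpBot_neg hφ hA hℓ
  · exact fun l hl => (mem_of_ucpDeriv_neg hφ hA hℓ hl).imp mem_posVars.2 id
  · rintro ⟨i, b⟩ (hl | ⟨rfl, -, hl⟩)
    · exact ucpDeriv_of_mem (Finset.mem_insert_of_mem hl)
    · exact ucpDeriv_neg_of_path Finset.subset_union_left (hmem _)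
        (ucpDeriv_of_mem (Finset.mem_insert_self _ _)) hl
  · rintro ⟨i, b⟩ (hl | ⟨rfl, -, hl⟩)
    · exact ucpDeriv_of_mem (Finset.mem_insert_of_mem hl)
    · exact ucpDeriv_pos_of_path Finset.subset_union_left (hmem _)
        (ucpDeriv_of_mem (Finset.mem_insert_self _ _)) hl
end

section
/- Assume integers a_1,…,a_r with a_i ≥ 2 for i = 1,…,r, and let m = ∑_{i=1}^{r} a_i. Then for every integer d with 2 ≤ d ≤ ⌊m/2⌋, the number of sets I ⊆ {1,…,r} such that ∑_{i∈I} a_i = d is at most binom(⌊m/2⌋, ⌊d/2⌋). -/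
/-- Binomial coefficients `choose n k` are monotone in `k` for `k ≤ n / 2`. -/
theorem Nat.choose_le_choose_of_le_half {n j k : ℕ} (hjk : j ≤ k) (hk : k ≤ n / 2) :
    n.choose j ≤ n.choose k := by
  induction k, hjk using Nat.le_induction with
  | base => rfl
  | succ k _ ih =>
    exact (ih (by lia)).trans (Nat.choose_le_succ_of_lt_half_left (by lia))

/-- A weighted form of Sperner's theorem: an antichain all of whose layers have size at most `N`
has at most `N` members. -/
theorem IsAntichain.card_le_of_choose_le {α : Type*} [Fintype α] {𝒜 : Finset (Finset α)}
    (h𝒜 : IsAntichain (· ⊆ ·) (SetLike.coe 𝒜)) {N : ℕ}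
    (hN : ∀ s ∈ 𝒜, (Fintype.card α).choose s.card ≤ N) : 𝒜.card ≤ N := by
  obtain rfl | ⟨s₀, hs₀⟩ := 𝒜.eq_empty_or_nonempty
  · simp
  have hpos : (0 : ℚ) < N :=
    Nat.cast_pos.2 ((Nat.choose_pos s₀.card_le_univ).trans_le (hN s₀ hs₀))
  have h : ∑ s ∈ 𝒜, (N : ℚ)⁻¹ ≤ 1 := by
    refine le_trans (Finset.sum_le_sum fun s hs => ?_)
      (Finset.lubell_yamamoto_meshalkin_inequality_sum_inv_choose (𝕜 := ℚ) h𝒜)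
    exact inv_anti₀ (Nat.cast_pos.2 (Nat.choose_pos s.card_le_univ)) (Nat.cast_le.2 (hN s hs))
  rw [Finset.sum_const, nsmul_eq_mul, ← div_eq_mul_inv, div_le_one hpos] at h
  exact_mod_cast h


/-- Assume integers `a₁, …, a_r` with `a_i ≥ 2`, and let `m = ∑ a_i`.
Then for every integer `d` with `2 ≤ d ≤ ⌊m/2⌋`, the number of sets `I ⊆ {1,…,r}` with
`∑_{i∈I} a_i = d` is at most `binom(⌊m/2⌋, ⌊d/2⌋)`. -/
theorem count_subset_sums_le {r : ℕ} (a : Fin r → ℕ) (ha : ∀ i, 2 ≤ a i)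
    {m : ℕ} (hm : m = ∑ i, a i) {d : ℕ} (hd₁ : 2 ≤ d) (hd₂ : d ≤ m / 2) :
    (Finset.univ.filter (fun I : Finset (Fin r) => ∑ i ∈ I, a i = d)).card ≤
      Nat.choose (m / 2) (d / 2) := by
  have two_mul_card_le (I : Finset (Fin r)) : 2 * I.card ≤ ∑ i ∈ I, a i := by
    simpa [mul_comm] using Finset.card_nsmul_le_sum I a 2 fun i _ => ha i
  have hr : r ≤ m / 2 := by
    have := two_mul_card_le Finset.univ
    rw [Finset.card_univ, Fintype.card_fin] at this
    lia
  refine IsAntichain.card_le_of_choose_le ?_ fun I hI => ?_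
  · intro I hI J hJ hne hIJ
    simp only [SetLike.mem_coe, Finset.mem_filter, Finset.mem_univ, true_and] at hI hJ
    have hlt : ∑ i ∈ I, a i < ∑ i ∈ J, a i := by
      obtain ⟨j, hjJ, hjI⟩ := Finset.exists_of_ssubset (hIJ.ssubset_of_ne hne)
      exact Finset.sum_lt_sum_of_subset hIJ hjJ hjI (by linarith [ha j]) fun _ _ _ => Nat.zero_le _
    lia
  · rw [Finset.mem_filter] at hI
    have := two_mul_card_le I
    rw [Fintype.card_fin]
    exact (Nat.choose_le_choose _ hr).trans
      (Nat.choose_le_choose_of_le_half (by lia) (by lia))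
end
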